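/- arXiv:1507.00190 — 6 statements merged into one kernel-verified Lean document; each statement's English description precedes it below -/
import Mathlib

section
/- Let 𝒞 = 𝒜G and let H₁, H₂ be as defined. If ρ is a group automorphism of H₁ such that the induced automorphism ρ∧ρ of H₁∧H₁ maps the subgroup H₂ into H₂, then ρ is either the identity or minus the identity of H₁. -/
/-- The point set `𝒫` of the combinatorics `𝒜G`, on the line set `Fin 12`
(index `i : Fin 12` corresponds to the line numbered `i+1` in the paper). -/
def calP : Finset (Finset (Fin 12)) :=
  { {0, 3, 4, 8, 11}, {0, 1, 5, 9}, {1, 2, 4, 6}, {2, 3, 5, 7}, {1, 7, 10, 11},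
    {0, 6, 10}, {2, 8, 10}, {3, 9, 10}, {4, 7, 9}, {5, 6, 8},
    {4, 5}, {4, 10}, {5, 10}, {0, 2}, {1, 3}, {0, 7}, {1, 8}, {2, 9}, {3, 6},
    {6, 7}, {6, 9}, {7, 8}, {8, 9}, {2, 11}, {5, 11}, {6, 11}, {9, 11} }

/-- `H₁`: the free abelian group on the twelve lines modulo the sum of all generators. -/
abbrev H1 : Type := (Fin 12 → ℤ) ⧸ (Submodule.span ℤ {(fun _ => (1 : ℤ) : Fin 12 → ℤ)})

/-- The class `x_L` of the generator attached to the line numbered `i+1`. -/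
def xL (i : Fin 12) : H1 := Submodule.Quotient.mk (Pi.single i 1)

/-- `x_P = Σ_{L ∈ P} x_L`. -/
def xP (P : Finset (Fin 12)) : H1 := ∑ i ∈ P, xL i

/-- The wedge product `x ∧ y` inside the exterior algebra of `H₁` over `ℤ`. -/
noncomputable def wedge (x y : H1) : ExteriorAlgebra ℤ H1 :=
  ExteriorAlgebra.ι ℤ x * ExteriorAlgebra.ι ℤ y

/-- `H₂ ⊆ H₁∧H₁`: the subgroup generated by the elements `x_L ∧ x_P`, `L ∈ P ∈ 𝒫`. -/
noncomputable def H2 : AddSubgroup (ExteriorAlgebra ℤ H1) :=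
  AddSubgroup.closure {w | ∃ P ∈ calP, ∃ L ∈ P, w = wedge (xL L) (xP P)}

/-- `List.all`, by direct recursion so that the kernel evaluates it quickly. -/
def allOf (l : List ℕ) (k : ℕ → Bool) : Bool :=
  List.rec true (fun a _ ih => Bool.rec false ih (k a)) l

def anyOf (l : List ℕ) (k : ℕ → Bool) : Bool :=
  List.rec false (fun a _ ih => Bool.rec ih true (k a)) l

def disj (a b : Bool) : Bool := Bool.rec b true a

def conj (a b : Bool) : Bool := Bool.rec false b a

/-- `k n`, with `n` evaluated first. -/
def force (n : ℕ) (k : ℕ → Bool) : Bool := Nat.rec (k 0) (fun m _ => k (m + 1)) n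

def pointList : List (List ℕ) :=
  [[0, 3, 4, 8, 11], [0, 1, 5, 9], [1, 2, 4, 6], [2, 3, 5, 7], [1, 7, 10, 11],
    [0, 6, 10], [2, 8, 10], [3, 9, 10], [4, 7, 9], [5, 6, 8],
    [4, 5], [4, 10], [5, 10], [0, 2], [1, 3], [0, 7], [1, 8], [2, 9], [3, 6],
    [6, 7], [6, 9], [7, 8], [8, 9], [2, 11], [5, 11], [6, 11], [9, 11]]

def lineList : List ℕ := [0, 1, 2, 3, 4, 5, 6, 7, 8, 9, 10, 11]

def pointsEndingAt : ℕ → List (List ℕ)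
  | 2 => [[0, 2]]
  | 3 => [[1, 3]]
  | 5 => [[4, 5]]
  | 6 => [[3, 6], [1, 2, 4, 6]]
  | 7 => [[0, 7], [6, 7], [2, 3, 5, 7]]
  | 8 => [[1, 8], [7, 8], [5, 6, 8]]
  | 9 => [[2, 9], [6, 9], [8, 9], [4, 7, 9], [0, 1, 5, 9]]
  | 10 => [[4, 10], [5, 10], [0, 6, 10], [2, 8, 10], [3, 9, 10]]
  | 11 => [[2, 11], [5, 11], [6, 11], [9, 11], [1, 7, 10, 11], [0, 3, 4, 8, 11]]
  | _ => []

def isParallel (f : ℕ → ℕ) (l : List ℕ) : Bool :=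
  anyOf l fun x => force (f x) fun a => conj (not (a.beq 12))
    (allOf l fun L => force (f L) fun b => disj (b.beq a) (b.beq 12))

def isConcurrent (f : ℕ → ℕ) : Bool :=
  pointList.any fun p => allOf lineList fun L => disj ((f L).beq 12) (anyOf p fun x => x.beq L)

def isPlanar (f : ℕ → ℕ) : Bool :=
  pointList.any fun p => anyOf p fun x => anyOf p fun y => anyOf p fun z =>
    conj (not ((f x).beq 12)) <| conj (not ((f y).beq 12)) <| conj (not ((f x).beq (f y))) <|
    conj (not (z.beq x)) <| conj (not (z.beq y)) <|
    conj (allOf p fun w => disj ((f w).beq 12) <| disj (w.beq x) <| disj (w.beq y) (w.beq z)) <|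
    allOf lineList fun L =>
      disj ((f L).beq 12) <| disj ((f L).beq (f x)) <| disj ((f L).beq (f y)) ((f L).beq (f z))

/-- A labelling `f` of the lines (the label `12` standing for a zero vector, equal labels for
parallel vectors) is admissible at `p` if no line of `p` is the only one off the common direction
of the others. -/
def admissible (f : ℕ → ℕ) (p : List ℕ) : Bool :=
  disj (isParallel f p) <| allOf p fun x => force (f x) fun a => disj (a.beq 12) <|
  allOf p fun y => force (f y) fun b => disj (b.beq 12) <| disj (a.beq b) <|
  anyOf p fun z => conj (not (z.beq x)) <|
    force (f z) fun c => conj (not (c.beq 12)) (not (c.beq b))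

def digit (n x : ℕ) : ℕ := n / 16 ^ x % 16

/-- Depth-first search through the admissible labellings whose first `i` labels are the
hexadecimal digits of `c`, with `n` lines left. -/
def allClassified : ℕ → ℕ → ℕ → Bool
  | 0, _, c =>
    disj (isParallel (digit c) lineList) (disj (isConcurrent (digit c)) (isPlanar (digit c)))
  | n + 1, i, c => allOf (12 :: lineList) fun v =>
      disj (not (disj (v.beq 12) (disj (v.beq i)
        (conj (Nat.ble (v + 1) i) ((digit c v).beq v))))) <|
      force (c + v * 16 ^ i) fun d =>
      disj (not ((pointsEndingAt i).all fun p => admissible (digit d) p))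
        (force (i + 1) fun j => allClassified n j d)

theorem allClassified_zero : allClassified 12 0 0 = true := by decide +kernel

theorem allOf_eq_true {l : List ℕ} {k : ℕ → Bool} : allOf l k = true ↔ ∀ x ∈ l, k x = true := by
  induction l with
  | nil => simp [allOf]
  | cons a l ih =>
    have : allOf (a :: l) k = Bool.rec false (allOf l k) (k a) := rfl
    rw [this]
    cases h : k a <;> simp [h, ih]

theorem anyOf_eq_true {l : List ℕ} {k : ℕ → Bool} : anyOf l k = true ↔ ∃ x ∈ l, k x = true := by
  induction l with
  | nil => simp [anyOf]
  | cons a l ih =>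
    have : anyOf (a :: l) k = Bool.rec (anyOf l k) true (k a) := rfl
    rw [this]
    cases h : k a <;> simp [h, ih]

theorem disj_eq_true {a b : Bool} : disj a b = true ↔ a = true ∨ b = true := by
  cases a <;> simp [disj]

theorem conj_eq_true {a b : Bool} : conj a b = true ↔ a = true ∧ b = true := by
  cases a <;> simp [conj]

theorem force_eq (n : ℕ) (k : ℕ → Bool) : force n k = k n := by
  cases n <;> rfl

theorem beq_eq_true {a b : ℕ} : a.beq b = true ↔ a = b := Nat.beq_eq ▸ Iff.rfl

theorem admissible_of_forall {f : ℕ → ℕ} {p : List ℕ}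
    (h : ∀ x ∈ p, ∀ y ∈ p, f x ≠ 12 → f y ≠ 12 → (∀ z ∈ p, z ≠ x → f z = 12 ∨ f z = f y) →
      f x = f y) : admissible f p = true := by
  simp only [admissible, disj_eq_true, conj_eq_true, allOf_eq_true, anyOf_eq_true, force_eq,
    Bool.not_eq_true', ← Bool.not_eq_true, beq_eq_true]
  refine Or.inr fun x hx => or_iff_not_imp_left.2 fun hx0 y hy => ?_
  by_contra! hc
  exact hc.2.1 (h x hx y hy hx0 hc.1 fun z hz hzx => or_iff_not_imp_left.2 (hc.2.2 z hz hzx))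

theorem admissible_congr {f g : ℕ → ℕ} {p : List ℕ} (h : ∀ x ∈ p, f x = g x)
    (hf : ∀ x ∈ p, ∀ y ∈ p, f x ≠ 12 → f y ≠ 12 → (∀ z ∈ p, z ≠ x → f z = 12 ∨ f z = f y) →
      f x = f y) : admissible g p = true := by
  refine admissible_of_forall fun x hx y hy => ?_
  rw [← h x hx, ← h y hy]
  intro h1 h2 h3
  exact hf x hx y hy h1 h2 fun z hz hzx => by rw [h z hz]; exact h3 z hz hzx

theorem pointsEndingAt_spec :
    ∀ i < 12, ∀ p ∈ pointsEndingAt i, p ∈ pointList ∧ ∀ x ∈ p, x ≤ i := by decide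

theorem digit_add_of_lt {c v i x : ℕ} (hx : x < i) : digit (c + v * 16 ^ i) x = digit c x := by
  obtain ⟨k, rfl⟩ := Nat.exists_eq_add_of_lt hx
  have : c + v * 16 ^ (x + k + 1) = c + 16 ^ x * (16 * (v * 16 ^ k)) := by ring
  rw [digit, digit, this, Nat.add_mul_div_left _ _ (by positivity), Nat.add_mul_mod_self_left]

theorem digit_add_self {c v i : ℕ} (hc : c < 16 ^ i) (hv : v < 16) :
    digit (c + v * 16 ^ i) i = v := by
  rw [digit, Nat.add_mul_div_right _ _ (by positivity), Nat.div_eq_of_lt hc, zero_add,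
    Nat.mod_eq_of_lt hv]

/-- The search covers every admissible labelling. -/
theorem exists_classified {f : ℕ → ℕ}
    (hf : ∀ x < 12, f x = 12 ∨ f x ≤ x ∧ f (f x) = f x)
    (hadm : ∀ p ∈ pointList, ∀ x ∈ p, ∀ y ∈ p, f x ≠ 12 → f y ≠ 12 →
      (∀ z ∈ p, z ≠ x → f z = 12 ∨ f z = f y) → f x = f y) :
    ∃ c, (∀ x < 12, digit c x = f x) ∧
      (isParallel (digit c) lineList = true ∨ isConcurrent (digit c) = true ∨
        isPlanar (digit c) = true) := by
  have key : ∀ n i c, i + n = 12 → c < 16 ^ i → (∀ x < i, digit c x = f x) →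
      allClassified n i c = true → ∃ c, (∀ x < 12, digit c x = f x) ∧
      (isParallel (digit c) lineList = true ∨ isConcurrent (digit c) = true ∨
        isPlanar (digit c) = true) := by
    intro n
    induction n with
    | zero =>
      intro i c hi hc hx h
      obtain rfl : i = 12 := hi
      exact ⟨c, hx, by simpa [allClassified, disj_eq_true] using h⟩
    | succ n ih =>
      intro i c hi hc hx h
      have hi' : i < 12 := by omega
      simp only [allClassified, disj_eq_true, conj_eq_true, allOf_eq_true, force_eq,
        Bool.not_eq_true', ← Bool.not_eq_true, beq_eq_true, Nat.ble_eq] at h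
      have hv : f i ≤ 12 := by rcases hf i hi' with h | h <;> omega
      have hmem : f i ∈ 12 :: lineList := by
        generalize f i = v at hv
        interval_cases v <;> decide
      have hd : ∀ x < i + 1, digit (c + f i * 16 ^ i) x = f x := by
        intro x hxi
        rcases Nat.lt_succ_iff_lt_or_eq.1 hxi with hlt | rfl
        · rw [digit_add_of_lt hlt, hx x hlt]
        · exact digit_add_self hc (by omega)
      rcases h (f i) hmem with h1 | h1 | h1
      · exfalso
        apply h1
        rcases hf i hi' with h2 | ⟨h2, h3⟩
        · exact Or.inl h2
        · rcases h2.lt_or_eq with h4 | h4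
          · exact Or.inr (Or.inr ⟨h4, by rw [hx _ h4, h3]⟩)
          · exact Or.inr (Or.inl h4)
      · exfalso
        apply h1
        rw [List.all_eq_true]
        intro p hp
        obtain ⟨hp1, hp2⟩ := pointsEndingAt_spec i hi' p hp
        exact admissible_congr (fun x hx => (hd x (Nat.lt_succ_of_le (hp2 x hx))).symm) (hadm p hp1)
      · refine ih (i + 1) _ (by omega) ?_ hd h1
        have : f i * 16 ^ i ≤ 15 * 16 ^ i := Nat.mul_le_mul_right _ (by omega)
        rw [pow_succ]
        omega
  exact key 12 0 0 rfl (by norm_num) (by simp) allClassified_zero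

section Parallel

variable {W : Type*}

/-- Proportionality of two integer-valued functions. -/
def Par (u v : W → ℤ) : Prop := ∀ a b, u a * v b = u b * v a

theorem Par.refl (u : W → ℤ) : Par u u := fun _ _ => mul_comm _ _

theorem Par.symm {u v : W → ℤ} (h : Par u v) : Par v u := fun a b => by
  rw [mul_comm, ← h, mul_comm]

theorem Par.trans {u v w : W → ℤ} (huv : Par u v) (hv : v ≠ 0) (hvw : Par v w) : Par u w := by
  obtain ⟨c, hc⟩ := Function.ne_iff.1 hv
  intro a b
  refine mul_right_cancel₀ hc ?_
  linear_combination w b * huv a c + u c * hvw a b - w a * huv b c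

theorem Par.eq_zero {u v : W → ℤ} (h : Par u v) (hv : v ≠ 0) {a : W} (ha : v a = 0) : u a = 0 := by
  obtain ⟨c, hc⟩ := Function.ne_iff.1 hv
  refine mul_right_cancel₀ hc ?_
  rw [h a c, ha]
  simp

theorem par_sum {l : List ℕ} {u : ℕ → W → ℤ} {v : W → ℤ} (h : ∀ x ∈ l, Par (u x) v) :
    Par (fun a => (l.map fun x => u x a).sum) v := by
  intro a b
  induction l with
  | nil => simp
  | cons x l ih =>
    have := ih fun y hy => h y (List.mem_cons_of_mem _ hy)
    have := h x List.mem_cons_self a b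
    simp only [List.map_cons, List.sum_cons] at *
    linarith

theorem par_of_forall_ne {p : List ℕ} (hp : p.Nodup) {u : ℕ → W → ℤ}
    (hu : ∀ x ∈ p, Par (u x) fun a => (p.map fun x => u x a).sum) {x y : ℕ} (hx : x ∈ p)
    (hy : y ∈ p) (h : ∀ z ∈ p, z ≠ x → u z = 0 ∨ Par (u z) (u y)) : Par (u x) (u y) := by
  have h1 : Par (fun a => ((p.erase x).map fun z => u z a).sum) (u y) := by
    refine par_sum fun z hz => ?_
    rw [hp.mem_erase_iff] at hz
    rcases h z hz.2 hz.1 with h | h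
    · simp [h, Par]
    · exact h
  have h2 := (hu y hy).symm
  intro a b
  have h3 := h1 a b
  have h4 := h2 a b
  have key : ∀ c, (p.map fun z => u z c).sum = u x c + ((p.erase x).map fun z => u z c).sum :=
    fun c => (List.sum_map_erase (fun z => u z c) hx).symm
  simp only [key] at h4
  linarith

open Classical in
/-- The index of the first nonzero function proportional to `u n`, and `12` if `u n` vanishes. -/
noncomputable def parallelLabel (u : ℕ → W → ℤ) (n : ℕ) : ℕ :=
  if h : u n = 0 then 12 else Nat.find (p := fun k => u k ≠ 0 ∧ Par (u k) (u n)) ⟨n, h, .refl _⟩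

variable {u : ℕ → W → ℤ} {m n : ℕ}

theorem parallelLabel_of_eq_zero (h : u n = 0) : parallelLabel u n = 12 := dif_pos h

theorem parallelLabel_le (h : u n ≠ 0) : parallelLabel u n ≤ n := by
  classical
  rw [parallelLabel, dif_neg h]
  exact Nat.find_min' _ ⟨h, .refl _⟩

theorem parallelLabel_spec (h : u n ≠ 0) :
    u (parallelLabel u n) ≠ 0 ∧ Par (u (parallelLabel u n)) (u n) := by
  classical
  rw [parallelLabel, dif_neg h]
  exact Nat.find_spec (p := fun k => u k ≠ 0 ∧ Par (u k) (u n)) _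

theorem Par.parallelLabel_eq (hm : u m ≠ 0) (hn : u n ≠ 0) (h : Par (u m) (u n)) :
    parallelLabel u m = parallelLabel u n := by
  classical
  rw [parallelLabel, parallelLabel, dif_neg hm, dif_neg hn]
  congr 1
  funext k
  exact propext (and_congr_right fun _ => ⟨fun hk => hk.trans hm h, fun hk => hk.trans hn h.symm⟩)

theorem parallelLabel_eq_twelve (hn : n < 12) : parallelLabel u n = 12 ↔ u n = 0 :=
  ⟨fun h => by_contra fun h0 => by have := parallelLabel_le h0; omega, parallelLabel_of_eq_zero⟩

theorem par_of_parallelLabel_eq (hm : u m ≠ 0) (hn : u n ≠ 0)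
    (h : parallelLabel u m = parallelLabel u n) : Par (u m) (u n) := by
  have h1 := parallelLabel_spec hm
  exact h1.2.symm.trans h1.1 (h ▸ (parallelLabel_spec hn).2)

theorem pointList_spec : ∀ p ∈ pointList, p.Nodup ∧ ∀ x ∈ p, x < 12 := by decide

theorem mem_lineList : ∀ x < 12, x ∈ lineList := by decide

theorem lt_of_mem_lineList : ∀ x ∈ lineList, x < 12 := by decide

/-- A family of functions satisfying the resonance relations is supported on a point, or it takes
values in a space of dimension at most two. -/
theorem concurrent_or_planar
    (hu : ∀ p ∈ pointList, ∀ x ∈ p, Par (u x) fun a => (p.map fun x => u x a).sum) :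
    (∃ p ∈ pointList, ∀ x < 12, x ∉ p → u x = 0) ∨
      ∃ x < 12, ∃ y < 12, ∀ a, u x a = 0 → u y a = 0 → ∀ z < 12, u z a = 0 := by
  have hlt : ∀ x < 12, parallelLabel u x ≠ 12 → u x ≠ 0 := fun x hx h h0 =>
    h (parallelLabel_of_eq_zero h0)
  have hzero : ∀ x < 12, ∀ y < 12, parallelLabel u x = parallelLabel u y → ∀ a, u y a = 0 →
      u x a = 0 := by
    intro x hx y hy hxy a ha
    by_cases hy0 : u y = 0
    · rw [(parallelLabel_eq_twelve hx).1 (hxy.trans (parallelLabel_of_eq_zero hy0)), Pi.zero_apply]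
    · by_cases hx0 : u x = 0
      · rw [hx0, Pi.zero_apply]
      · exact (par_of_parallelLabel_eq hx0 hy0 hxy).eq_zero hy0 ha
  obtain ⟨c, hc, h⟩ := exists_classified (f := parallelLabel u) (by
      intro x hx
      by_cases h0 : u x = 0
      · exact Or.inl (parallelLabel_of_eq_zero h0)
      · exact Or.inr ⟨parallelLabel_le h0,
          (parallelLabel_spec h0).2.parallelLabel_eq (parallelLabel_spec h0).1 h0⟩) (by
      intro p hp x hx y hy hx0 hy0 h
      obtain ⟨hnd, hp12⟩ := pointList_spec p hp
      refine Par.parallelLabel_eq (hlt x (hp12 x hx) hx0) (hlt y (hp12 y hy) hy0) ?_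
      refine par_of_forall_ne hnd (hu p hp) hx hy fun z hz hzx => ?_
      rw [← parallelLabel_eq_twelve (hp12 z hz), or_iff_not_imp_left]
      exact fun hz0 => par_of_parallelLabel_eq (hlt z (hp12 z hz) hz0) (hlt y (hp12 y hy) hy0)
        ((h z hz hzx).resolve_left hz0))
  simp only [isParallel, isConcurrent, isPlanar, disj_eq_true, conj_eq_true, allOf_eq_true,
    anyOf_eq_true, force_eq, Bool.not_eq_true', ← Bool.not_eq_true, beq_eq_true,
    List.any_eq_true] at h
  rcases h with ⟨x, hx, -, h⟩ | ⟨p, hp, h⟩ | ⟨p, hp, x, hx, y, hy, z, hz, hx0, hy0, hxy, hzx, hzy,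
    hpw, h⟩
  · have hx12 := lt_of_mem_lineList x hx
    refine Or.inr ⟨x, hx12, x, hx12, fun a ha _ z hz => ?_⟩
    have := h z (mem_lineList z hz)
    rw [hc z hz, hc x hx12] at this
    rcases this with h1 | h1
    · exact hzero z hz x hx12 h1 a ha
    · rw [(parallelLabel_eq_twelve hz).1 h1, Pi.zero_apply]
  · refine Or.inl ⟨p, hp, fun x hx hxp => ?_⟩
    have := h x (mem_lineList x hx)
    rw [hc x hx, parallelLabel_eq_twelve hx] at this
    refine this.resolve_right ?_
    rintro ⟨y, hy, rfl⟩
    exact hxp hy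
  · obtain ⟨hnd, hp12⟩ := pointList_spec p hp
    have hx12 := hp12 x hx
    have hy12 := hp12 y hy
    have hz12 := hp12 z hz
    rw [hc x hx12, parallelLabel_eq_twelve hx12] at hx0
    rw [hc y hy12, parallelLabel_eq_twelve hy12] at hy0
    rw [hc x hx12, hc y hy12] at hxy
    have hS : (fun a => (p.map fun x => u x a).sum) = 0 := by
      by_contra hS
      exact hxy (((hu p hp x hx).trans hS (hu p hp y hy).symm).parallelLabel_eq hx0 hy0)
    refine Or.inr ⟨x, hx12, y, hy12, fun a hxa hya w hw => ?_⟩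
    have hza : u z a = 0 := by
      have h1 := congrFun hS a
      rw [Pi.zero_apply, List.sum_map_eq_nsmul_single z, List.count_eq_one_of_mem hnd hz,
        one_smul] at h1
      · exact h1
      · intro w hwz hwp
        rcases hpw w hwp with h | rfl | rfl | rfl
        · rw [hc w (hp12 w hwp), parallelLabel_eq_twelve (hp12 w hwp)] at h
          rw [h, Pi.zero_apply]
        · exact hxa
        · exact hya
        · exact absurd rfl hwz
    have := h w (mem_lineList w hw)
    rw [hc w hw, hc x hx12, hc y hy12, hc z hz12] at this
    rcases this with h1 | h1 | h1 | h1
    · rw [(parallelLabel_eq_twelve hw).1 h1, Pi.zero_apply]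
    · exact hzero w hw x hx12 h1 a hxa
    · exact hzero w hw y hy12 h1 a hya
    · exact hzero w hw z hz12 h1 a hza

end Parallel

/-- The vectors `a`, `b` of sum zero, seen as forms on `H1`, have a wedge product vanishing
on `H2`. -/
def Resonant (a b : Fin 12 → ℤ) : Prop :=
  ∀ P ∈ calP, ∀ L ∈ P, a L * ∑ K ∈ P, b K = (∑ K ∈ P, a K) * b L

/-- The vectors of sum zero supported on `Q`. -/
def localSpace (Q : Finset (Fin 12)) : Submodule ℤ (Fin 12 → ℤ) where
  carrier := {a | ∑ x, a x = 0 ∧ ∀ x ∉ Q, a x = 0}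
  zero_mem' := by simp
  add_mem' := by
    rintro a b ⟨ha, ha'⟩ ⟨hb, hb'⟩
    refine ⟨by simp [Finset.sum_add_distrib, ha, hb], fun x hx => by simp [ha' x hx, hb' x hx]⟩
  smul_mem' := by
    rintro c a ⟨ha, ha'⟩
    refine ⟨by simp [← Finset.mul_sum, ha], fun x hx => by simp [ha' x hx]⟩

theorem finrank_localSpace {Q : Finset (Fin 12)} (hQ : Q.Nonempty) :
    Module.finrank ℤ (localSpace Q) + 1 = Q.card := by
  obtain ⟨q, hq⟩ := hQ
  have hsum : ∀ a ∈ localSpace Q, a q = - ∑ x ∈ Q.erase q, a x := by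
    intro a ha
    have h1 : ∑ x ∈ Q, a x = 0 := by
      rw [← ha.1]
      exact Finset.sum_subset (Finset.subset_univ _) fun x _ hx => ha.2 x hx
    rw [← Finset.add_sum_erase _ _ hq] at h1
    omega
  let e : localSpace Q ≃ₗ[ℤ] (Q.erase q → ℤ) :=
    { toFun := fun a x => a.1 x
      map_add' := fun _ _ => rfl
      map_smul' := fun _ _ => rfl
      invFun := fun f => ⟨fun x => if h : x ∈ Q.erase q then f ⟨x, h⟩ else
          if x = q then - ∑ y, f y else 0, by
        refine ⟨?_, fun x hx => ?_⟩
        · rw [← Finset.add_sum_erase _ _ (Finset.mem_univ q), dif_neg (by simp), if_pos rfl,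
            ← Finset.sum_subset (Finset.erase_subset_erase q (Finset.subset_univ Q)),
            ← Finset.sum_coe_sort (Q.erase q)]
          · rw [neg_add_eq_zero]
            exact Finset.sum_congr rfl fun y _ => by rw [dif_pos y.2]
          · intro x hx hx'
            rw [dif_neg hx', if_neg (Finset.ne_of_mem_erase hx)]
        · exact (dif_neg (by simp [hx])).trans (if_neg (by rintro rfl; exact hx hq))⟩
      left_inv := fun a => by
        ext x
        by_cases h : x ∈ Q.erase q
        · simp only [dif_pos h]
        · simp only [dif_neg h]
          split_ifs with hxq
          · subst hxq
            rw [hsum a.1 a.2, ← Finset.sum_coe_sort (Q.erase x)]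
          · exact (a.2.2 x fun hx => h (Finset.mem_erase.2 ⟨hxq, hx⟩)).symm
      right_inv := fun f => by
        funext x
        exact dif_pos x.2 }
  rw [e.finrank_eq, Module.finrank_fintype_fun_eq_card, Fintype.card_coe,
    Finset.card_erase_add_one hq]

def toPoint (p : List ℕ) : Finset (Fin 12) := (p.map (Fin.ofNat 12)).toFinset

theorem calP_eq : calP = (pointList.map toPoint).toFinset := by decide +kernel

theorem mem_calP {P : Finset (Fin 12)} : P ∈ calP ↔ ∃ p ∈ pointList, toPoint p = P := by
  simp [calP_eq]

theorem mem_toPoint {p : List ℕ} (hp : p ∈ pointList) {x : Fin 12} :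
    x ∈ toPoint p ↔ x.val ∈ p := by
  have h := (pointList_spec p hp).2
  simp only [toPoint, List.mem_toFinset, List.mem_map]
  constructor
  · rintro ⟨y, hy, rfl⟩
    rwa [Fin.val_ofNat, Nat.mod_eq_of_lt (h y hy)]
  · exact fun hx => ⟨x, hx, by simp⟩

theorem calP_inter {P Q : Finset (Fin 12)} (hP : P ∈ calP) (hQ : Q ∈ calP) (hne : P ≠ Q)
    {x y : Fin 12} (hx : x ∈ P ∩ Q) (hy : y ∈ P ∩ Q) : x = y := by
  obtain ⟨p, hp, rfl⟩ := mem_calP.1 hP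
  obtain ⟨q, hq, rfl⟩ := mem_calP.1 hQ
  have : ∀ p ∈ pointList, ∀ q ∈ pointList, p = q ∨
      ∀ x ∈ p, x ∈ q → ∀ y ∈ p, y ∈ q → x = y := by decide +kernel
  rw [Finset.mem_inter, mem_toPoint hp, mem_toPoint hq] at hx hy
  exact Fin.ext ((this p hp q hq).resolve_left (fun h => hne (by rw [h])) x hx.1 hx.2 y hy.1 hy.2)

theorem sum_eq_sum_inter {Q : Finset (Fin 12)} {a : Fin 12 → ℤ} (ha : ∀ x ∉ Q, a x = 0)
    (P : Finset (Fin 12)) : ∑ x ∈ P, a x = ∑ x ∈ P ∩ Q, a x :=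
  (Finset.sum_subset Finset.inter_subset_left fun x hx hxQ =>
    ha x fun h => hxQ (Finset.mem_inter.2 ⟨hx, h⟩)).symm

theorem resonant_of_mem_localSpace {Q : Finset (Fin 12)} (hQ : Q ∈ calP) {a b : Fin 12 → ℤ}
    (ha : a ∈ localSpace Q) (hb : b ∈ localSpace Q) : Resonant a b := by
  intro P hP L hL
  rw [sum_eq_sum_inter ha.2, sum_eq_sum_inter hb.2]
  by_cases hPQ : P = Q
  · subst hPQ
    have h1 := sum_eq_sum_inter ha.2 Finset.univ
    have h2 := sum_eq_sum_inter hb.2 Finset.univ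
    rw [ha.1, Finset.univ_inter] at h1
    rw [hb.1, Finset.univ_inter] at h2
    rw [Finset.inter_self, ← h1, ← h2, mul_zero, zero_mul]
  by_cases hLQ : L ∈ Q
  · have hLPQ := Finset.mem_inter.2 ⟨hL, hLQ⟩
    rw [Finset.eq_singleton_iff_unique_mem.2
      ⟨hLPQ, fun x hx => calP_inter hP hQ hPQ hx hLPQ⟩, Finset.sum_singleton,
      Finset.sum_singleton]
  · rw [ha.2 L hLQ, hb.2 L hLQ, zero_mul, mul_zero]

theorem sum_toPoint {p : List ℕ} (hp : p ∈ pointList) (a : Fin 12 → ℤ) :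
    ∑ x ∈ toPoint p, a x = (p.map fun x => a (Fin.ofNat 12 x)).sum := by
  have hnd : (p.map (Fin.ofNat 12)).Nodup := by
    refine (List.nodup_map_iff_inj_on (pointList_spec p hp).1).2 fun x hx y hy h => ?_
    have := congrArg Fin.val h
    rwa [Fin.val_ofNat, Fin.val_ofNat, Nat.mod_eq_of_lt ((pointList_spec p hp).2 x hx),
      Nat.mod_eq_of_lt ((pointList_spec p hp).2 y hy)] at this
  rw [toPoint, List.sum_toFinset _ hnd, List.map_map]
  rfl

/-- A linear map preserving, on vectors of sum zero, the sum and resonance, and injective there. -/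
structure PreservesResonance (G : (Fin 12 → ℤ) →ₗ[ℤ] (Fin 12 → ℤ)) : Prop where
  sum_eq_zero : ∀ a, ∑ x, a x = 0 → ∑ x, G a x = 0
  eq_zero : ∀ a, ∑ x, a x = 0 → G a = 0 → a = 0
  resonant : ∀ a b, ∑ x, a x = 0 → ∑ x, b x = 0 → Resonant a b → Resonant (G a) (G b)

section

variable {G : (Fin 12 → ℤ) →ₗ[ℤ] (Fin 12 → ℤ)} {P Q : Finset (Fin 12)}

theorem PreservesResonance.finrank_le (hG : PreservesResonance G) {W : Type*} [AddCommGroup W]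
    [Module ℤ W] [Module.Finite ℤ W] (f : localSpace P →ₗ[ℤ] W)
    (hf : ∀ a, f a = 0 → G a.1 = 0) :
    Module.finrank ℤ (localSpace P) ≤ Module.finrank ℤ W :=
  LinearMap.finrank_le_finrank_of_injective ((injective_iff_map_eq_zero f).2 fun a ha =>
    Subtype.ext (hG.eq_zero a a.2.1 (hf a ha)))

/-- A subspace of pairwise resonant vectors of rank at least three is supported on a point. -/
theorem PreservesResonance.exists_map_localSpace_le (hG : PreservesResonance G)
    (hP : P ∈ calP) (hcard : 4 ≤ P.card) :
    ∃ Q ∈ calP, P.card ≤ Q.card ∧ ∀ a ∈ localSpace P, G a ∈ localSpace Q := by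
  have hrank := finrank_localSpace (Finset.card_pos.1 (by omega : 0 < P.card))
  rcases concurrent_or_planar (u := fun n (a : localSpace P) => G a.1 (Fin.ofNat 12 n)) (by
      intro p hp x hx a b
      have := hG.resonant a b a.2.1 b.2.1 (resonant_of_mem_localSpace hP a.2 b.2) _
        (mem_calP.2 ⟨p, hp, rfl⟩) (Fin.ofNat 12 x) (List.mem_toFinset.2 (List.mem_map_of_mem hx))
      rw [sum_toPoint hp, sum_toPoint hp] at this
      rw [this, mul_comm]) with
    ⟨p, hp, h⟩ | ⟨x, -, y, -, h⟩
  · have hmem : ∀ a ∈ localSpace P, G a ∈ localSpace (toPoint p) := by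
      refine fun a ha => ⟨hG.sum_eq_zero a ha.1, fun x hx => ?_⟩
      have := congrFun (h x x.2 fun hxp => hx ((mem_toPoint hp).2 hxp)) ⟨a, ha⟩
      simpa using this
    refine ⟨_, mem_calP.2 ⟨p, hp, rfl⟩, ?_, hmem⟩
    have h1 := hG.finrank_le (G.restrict hmem) fun a ha => congrArg Subtype.val ha
    have h2 : (toPoint p).Nonempty :=
      List.toFinset_nonempty_iff _ |>.2 (by
        rw [Ne, List.map_eq_nil_iff]
        rintro rfl
        exact absurd hp (by decide))
    have := finrank_localSpace h2
    omega
  · exfalso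
    let f : localSpace P →ₗ[ℤ] ℤ × ℤ :=
      (((LinearMap.proj (Fin.ofNat 12 x)).comp G).prod
        ((LinearMap.proj (Fin.ofNat 12 y)).comp G)).comp (localSpace P).subtype
    have h1 := hG.finrank_le f fun a ha => funext fun z => by
      have := h a (congrArg Prod.fst ha) (congrArg Prod.snd ha) z z.2
      simpa using this
    rw [Module.finrank_prod, Module.finrank_self] at h1
    omega

end

section Diff

/-- The vector with entry `1` at `x` and `-1` at `y`. -/
def diff (x y : Fin 12) : Fin 12 → ℤ := Pi.single x 1 - Pi.single y 1

variable {P Q R : Finset (Fin 12)} {u v w : Fin 12 → ℤ} {x y z : Fin 12}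

theorem sum_diff (x y : Fin 12) : ∑ t, diff x y t = 0 := by
  simp [diff]

theorem diff_apply (x y t : Fin 12) :
    diff x y t = (if t = x then 1 else 0) - if t = y then 1 else 0 := by
  simp [diff, Pi.single_apply]

theorem diff_add_diff (x y z : Fin 12) : diff x y + diff y z = diff x z := by
  simp [diff]

theorem diff_self (x : Fin 12) : diff x x = 0 := sub_self _

theorem neg_diff (x y : Fin 12) : -diff x y = diff y x := neg_sub _ _

theorem diff_mem_localSpace (hx : x ∈ P) (hy : y ∈ P) : diff x y ∈ localSpace P := by
  refine ⟨sum_diff x y, fun t ht => ?_⟩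
  rw [diff_apply, if_neg (by rintro rfl; exact ht hx), if_neg (by rintro rfl; exact ht hy),
    sub_zero]

theorem eq_smul_diff (hxy : x ≠ y) (hsum : ∑ t, u t = 0) (h : ∀ t, t ≠ x → t ≠ y → u t = 0) :
    u = u x • diff x y := by
  have h1 : u x + u y = 0 := by
    rw [← hsum]
    exact (Finset.sum_eq_add x y hxy (fun t _ ht => h t ht.1 ht.2) (by simp) (by simp)).symm
  funext t
  rw [Pi.smul_apply, diff_apply, smul_eq_mul]
  by_cases htx : t = x
  · simp [htx, hxy]
  by_cases hty : t = y
  · simp only [hty, hxy.symm, if_true, if_false]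
    omega
  · simp [htx, hty, h t htx hty]

/-- Vectors on the three sides of a triangle add up to zero only if they are proportional to the
differences of the vertices. -/
theorem triangle (hu : u ∈ localSpace P) (hv : v ∈ localSpace Q) (hw : w ∈ localSpace R)
    (h : u + v + w = 0) (hPQ : ∀ t ∈ P, t ∈ Q → t = x) (hQR : ∀ t ∈ Q, t ∈ R → t = y)
    (hPR : ∀ t ∈ P, t ∈ R → t = z) (hxy : x ≠ y) (hyz : y ≠ z) (hzx : z ≠ x) :
    ∃ c : ℤ, u = c • diff z x ∧ v = c • diff x y ∧ w = c • diff y z := by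
  have h' : ∀ t, u t + v t + w t = 0 := fun t => congrFun h t
  have hu' := eq_smul_diff (x := z) (y := x) hzx hu.1 fun t htz htx => by
    by_cases ht : t ∈ P
    · have := h' t
      rwa [hv.2 t fun h => htx (hPQ t ht h), hw.2 t fun h => htz (hPR t ht h), add_zero,
        add_zero] at this
    · exact hu.2 t ht
  have hv' := eq_smul_diff (x := x) (y := y) hxy hv.1 fun t htx hty => by
    by_cases ht : t ∈ Q
    · have := h' t
      rwa [hu.2 t fun h => htx (hPQ t h ht), hw.2 t fun h => hty (hQR t ht h), add_zero,
        zero_add] at this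
    · exact hv.2 t ht
  have hw' := eq_smul_diff (x := y) (y := z) hyz hw.1 fun t hty htz => by
    by_cases ht : t ∈ R
    · have := h' t
      rwa [hu.2 t fun h => htz (hPR t h ht), hv.2 t fun h => hty (hQR t h ht), zero_add,
        zero_add] at this
    · exact hw.2 t ht
  have h1 := h' x
  have h2 := h' y
  rw [hu', hv', hw'] at h1 h2
  simp [diff_apply, hxy, hyz, hxy.symm, hzx.symm] at h1 h2
  refine ⟨u z, hu', ?_, ?_⟩
  · rwa [show u z = v x by omega]
  · rwa [show u z = w y by omega]

theorem concurrent (hu : u ∈ localSpace P) (hv : v ∈ localSpace Q) (hw : w ∈ localSpace R)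
    (h : u + v + w = 0) (hPQ : ∀ t ∈ P, t ∈ Q → t = x) (hPR : ∀ t ∈ P, t ∈ R → t = x) :
    u = 0 := by
  have h1 : ∀ t, t ≠ x → u t = 0 := fun t htx => by
    by_cases ht : t ∈ P
    · have : u t + v t + w t = 0 := congrFun h t
      rwa [hv.2 t fun h => htx (hPQ t ht h), hw.2 t fun h => htx (hPR t ht h), add_zero,
        add_zero] at this
    · exact hu.2 t ht
  have h2 := hu.1
  rw [Finset.sum_eq_single x (fun t _ => h1 t) (by simp)] at h2
  funext t
  by_cases htx : t = x
  · rw [htx, h2, Pi.zero_apply]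
  · exact h1 t htx

theorem Resonant.sum_eq_apply {c : ℤ} (hc : c ≠ 0) (h : Resonant u (c • diff x y)) (hP : P ∈ calP)
    (hx : x ∈ P) (hy : y ∉ P) : ∑ t ∈ P, u t = u x := by
  have hxy : x ≠ y := by rintro rfl; exact hy hx
  have := h P hP x hx
  simp [diff_apply, mul_sub, Finset.sum_sub_distrib, hx, hy, hxy] at this
  exact (this.resolve_right hc).symm

theorem Resonant.sum_eq_zero {c : ℤ} (hc : c ≠ 0) (h : Resonant u (c • diff x y)) (hP : P ∈ calP)
    (hx : x ∈ P) (hy : y ∈ P) (hxy : x ≠ y) : ∑ t ∈ P, u t = 0 := by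
  have := h P hP x hx
  simp [diff_apply, mul_sub, Finset.sum_sub_distrib, hx, hy, hxy] at this
  exact this.resolve_right hc

end Diff

/-- The points of multiplicity at least four. -/
def bigPoint : Fin 5 → Finset (Fin 12) :=
  ![{0, 3, 4, 8, 11}, {0, 1, 5, 9}, {1, 2, 4, 6}, {2, 3, 5, 7}, {1, 7, 10, 11}]

/-- The three points of multiplicity four that lie on the line `1`. -/
def pencil : Finset (Fin 5) := {1, 2, 4}

/-- The line through `bigPoint 0` and `bigPoint k`, for `k ∈ pencil`. -/
def lineA : Fin 5 → Fin 12 := ![8, 0, 4, 8, 11]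

/-- The line through `bigPoint 3` and `bigPoint k`, for `k ∈ pencil`. -/
def lineB : Fin 5 → Fin 12 := ![8, 5, 2, 8, 7]

/-- The fourth line through `bigPoint k`, for `k ∈ pencil`. -/
def lineC : Fin 5 → Fin 12 := ![8, 9, 6, 8, 10]

theorem bigPoint_mem : ∀ k, bigPoint k ∈ calP := by decide +kernel

theorem exists_eq_bigPoint {P : Finset (Fin 12)} (hP : P ∈ calP) (hcard : 4 ≤ P.card) :
    ∃ k, P = bigPoint k := by
  have : ∀ p ∈ pointList, 4 ≤ (toPoint p).card → ∃ k, toPoint p = bigPoint k := by decide +kernel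
  obtain ⟨p, hp, rfl⟩ := mem_calP.1 hP
  exact this p hp hcard

theorem card_bigPoint : ∀ k, 4 ≤ (bigPoint k).card ∧ (bigPoint k).card ≤ 5 ∧
    ((bigPoint k).card = 5 ↔ k = 0) := by decide

theorem inter_zero_three : ∀ t ∈ bigPoint 0, t ∈ bigPoint 3 → t = 3 := by decide

theorem inter_zero : ∀ k ∈ pencil, ∀ t ∈ bigPoint 0, t ∈ bigPoint k → t = lineA k := by decide

theorem inter_three : ∀ k ∈ pencil, ∀ t ∈ bigPoint 3, t ∈ bigPoint k → t = lineB k := by decide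

theorem inter_pencil : ∀ k ∈ pencil, ∀ l ∈ pencil, k ≠ l →
    ∀ t ∈ bigPoint k, t ∈ bigPoint l → t = 1 := by decide +kernel

theorem pencil_spec : ∀ k ∈ pencil, 1 ∈ bigPoint k ∧ 3 ∉ bigPoint k ∧ lineA k ∈ bigPoint 0 ∧
    lineA k ∈ bigPoint k ∧ lineB k ∈ bigPoint 3 ∧ lineB k ∈ bigPoint k ∧ lineC k ∈ bigPoint k ∧
    ∀ x ∈ bigPoint k, x = lineA k ∨ x = lineB k ∨ x = 1 ∨ x = lineC k := by decide

theorem pencil_ne : ∀ k ∈ pencil, lineA k ≠ 1 ∧ lineA k ≠ 3 ∧ lineB k ≠ 1 ∧ lineB k ≠ 3 ∧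
    lineA k ≠ lineB k ∧ lineC k ≠ lineA k ∧ lineC k ≠ lineB k ∧ lineC k ≠ 1 ∧ lineC k ≠ 3 := by
  decide

theorem lineA_ne : ∀ k ∈ pencil, ∀ l ∈ pencil, k ≠ l → lineA k ≠ lineA l := by decide

theorem exists_join_three : ∀ k ∈ pencil, ∀ x ∈ bigPoint k, x ≠ 1 →
    ∃ P ∈ calP, 3 ∈ P ∧ x ∈ P ∧ ∀ t ∈ P, t ∈ bigPoint k → t = x := by decide +kernel

theorem exists_join_three_lineC : ∀ k ∈ pencil, ∀ l ∈ pencil, k ≠ l →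
    (k = 1 ∧ l = 4) ∨ (k = 4 ∧ l = 1) ∨ ∃ P ∈ calP, 3 ∈ P ∧ lineC k ∈ P ∧
      (∀ t ∈ P, t ∈ bigPoint k → t = lineC k) ∧ ∀ t ∈ P, t ∉ bigPoint l := by decide +kernel

theorem exists_inter_bigPoint : ∀ k l, k ≠ l →
    ∃ x, ∀ t ∈ bigPoint k, t ∈ bigPoint l → t = x := by decide

section Rigidity

variable {G : (Fin 12 → ℤ) →ₗ[ℤ] (Fin 12 → ℤ)} {σ : Fin 5 → Fin 5} {P : Finset (Fin 12)}

theorem PreservesResonance.exists_perm (hG : PreservesResonance G) :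
    ∃ σ : Fin 5 → Fin 5, Function.Injective σ ∧ σ 0 = 0 ∧
      ∀ k, ∀ a ∈ localSpace (bigPoint k), G a ∈ localSpace (bigPoint (σ k)) := by
  have : ∀ k, ∃ l, (bigPoint k).card ≤ (bigPoint l).card ∧
      ∀ a ∈ localSpace (bigPoint k), G a ∈ localSpace (bigPoint l) := by
    intro k
    have hcard := (card_bigPoint k).1
    obtain ⟨Q, hQ, hle, h⟩ := hG.exists_map_localSpace_le (bigPoint_mem k) hcard
    obtain ⟨l, rfl⟩ := exists_eq_bigPoint hQ (hcard.trans hle)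
    exact ⟨l, hle, h⟩
  choose σ hle hσ using this
  refine ⟨σ, fun k l hkl => ?_, ?_, hσ⟩
  · by_contra hne
    have hl := hσ l
    rw [← hkl] at hl
    have hinj : Function.Injective (LinearMap.coprod (G.restrict (hσ k)) (G.restrict hl)) := by
      refine (injective_iff_map_eq_zero _).2 ?_
      rintro ⟨⟨a, ha⟩, ⟨b, hb⟩⟩ hab
      have h1 : G (a + b) = 0 := by
        rw [map_add]
        exact congrArg Subtype.val hab
      have h2 := hG.eq_zero (a + b) (by simp [Finset.sum_add_distrib, ha.1, hb.1]) h1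
      obtain ⟨x, hx⟩ := exists_inter_bigPoint k l hne
      have h3 : a = 0 := concurrent ha hb (Submodule.zero_mem (localSpace (bigPoint l)))
        (by rw [h2, add_zero]) hx hx
      rw [h3, zero_add] at h2
      subst h3 h2
      rfl
    have hrank := LinearMap.finrank_le_finrank_of_injective hinj
    rw [Module.finrank_prod] at hrank
    have hr : ∀ k, Module.finrank ℤ (localSpace (bigPoint k)) + 1 = (bigPoint k).card :=
      fun k => finrank_localSpace (Finset.card_pos.1 (by have := (card_bigPoint k).1; omega))
    have := hr k
    have := hr l
    have := hr (σ k)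
    have := card_bigPoint k
    have := card_bigPoint l
    have := card_bigPoint (σ k)
    omega
  · have h0 := hle 0
    rw [(card_bigPoint 0).2.2.2 rfl] at h0
    exact (card_bigPoint (σ 0)).2.2.1 (le_antisymm (card_bigPoint (σ 0)).2.1 h0)

theorem perm_three : ∀ s : Fin 5, s ≠ 0 → s ≠ 3 → s ∈ pencil := by decide

theorem PreservesResonance.map_diff_ne_zero (hG : PreservesResonance G) {x y : Fin 12}
    (hxy : x ≠ y) : G (diff x y) ≠ 0 := fun h => by
  have := congrFun (hG.eq_zero _ (sum_diff x y) h) x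
  simp [diff_apply, hxy] at this

theorem exists_pair_pencil (hσ : Function.Injective σ) (h0 : σ 0 = 0) :
    ∃ a ∈ pencil, ∃ b ∈ pencil, a ≠ b ∧ σ a ∈ pencil ∧ σ b ∈ pencil := by
  have hp : ∀ k, k ≠ 0 → σ k ≠ 3 → σ k ∈ pencil := fun k hk h =>
    perm_three _ (fun h' => hk (hσ (h'.trans h0.symm))) h
  by_cases h1 : σ 1 = 3
  · refine ⟨2, by decide, 4, by decide, by decide, hp 2 (by decide) fun h => ?_,
      hp 4 (by decide) fun h => ?_⟩ <;> exact absurd (hσ (h.trans h1.symm)) (by decide)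
  · by_cases h2 : σ 2 = 3
    · exact ⟨1, by decide, 4, by decide, by decide, hp 1 (by decide) h1,
        hp 4 (by decide) fun h => absurd (hσ (h.trans h2.symm)) (by decide)⟩
    · exact ⟨1, by decide, 2, by decide, by decide, hp 1 (by decide) h1, hp 2 (by decide) h2⟩

theorem PreservesResonance.perm_three_eq (hG : PreservesResonance G)
    (hσ : Function.Injective σ) (h0 : σ 0 = 0)
    (h : ∀ k, ∀ a ∈ localSpace (bigPoint k), G a ∈ localSpace (bigPoint (σ k))) : σ 3 = 3 := by
  by_contra h3
  obtain ⟨a, ha, b, hb, hab, hσa, hσb⟩ := exists_pair_pencil hσ h0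
  have hσ3 : σ 3 ∈ pencil := perm_three _
    (fun h' => absurd (hσ (h'.trans h0.symm)) (by decide)) h3
  obtain ⟨a1, -, -, -, a5, a6, -⟩ := pencil_spec a ha
  obtain ⟨b1, -, -, -, b5, b6, -⟩ := pencil_spec b hb
  have ha3 : a ≠ 3 := by rintro rfl; exact absurd ha (by decide)
  refine hG.map_diff_ne_zero (pencil_ne a ha).2.2.1.symm (concurrent (x := 1)
    (h a _ (diff_mem_localSpace a1 a6)) (h 3 _ (diff_mem_localSpace a5 b5))
    (h b _ (diff_mem_localSpace b6 b1)) ?_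
    (inter_pencil _ hσa _ hσ3 (hσ.ne ha3)) (inter_pencil _ hσa _ hσb (hσ.ne hab)))
  rw [← map_add, ← map_add, diff_add_diff, diff_add_diff, diff_self, map_zero]

/-- The linear map acts on the differences of the lines `1`, `3` and `lineA`, `lineB` by a
permutation and a common factor. -/
theorem PreservesResonance.exists_smul (hG : PreservesResonance G)
    (hσp : ∀ k ∈ pencil, σ k ∈ pencil) (hσ : Function.Injective σ) (h0 : σ 0 = 0) (h3 : σ 3 = 3)
    (h : ∀ k, ∀ a ∈ localSpace (bigPoint k), G a ∈ localSpace (bigPoint (σ k))) :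
    ∃ c : ℤ, c ≠ 0 ∧ G (diff 3 1) = c • diff 3 1 ∧ ∀ k ∈ pencil,
      G (diff 3 (lineA k)) = c • diff 3 (lineA (σ k)) ∧
      G (diff 3 (lineB k)) = c • diff 3 (lineB (σ k)) := by
  have hfactor : ∀ k ∈ pencil, ∃ c : ℤ,
      G (diff (lineA k) 3) = c • diff (lineA (σ k)) 3 ∧
      G (diff 3 (lineB k)) = c • diff 3 (lineB (σ k)) := by
    intro k hk
    obtain ⟨-, -, k3, k4, k5, k6, -⟩ := pencil_spec k hk
    obtain ⟨-, n2, -, n4, n5, -⟩ := pencil_ne _ (hσp k hk)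
    have e1 := h 0 _ (diff_mem_localSpace k3 (by decide : (3 : Fin 12) ∈ bigPoint 0))
    have e2 := h 3 _ (diff_mem_localSpace (by decide : (3 : Fin 12) ∈ bigPoint 3) k5)
    have e3 := h k _ (diff_mem_localSpace k6 k4)
    rw [h0] at e1
    rw [h3] at e2
    obtain ⟨c, h1, h2, -⟩ := triangle e1 e2 e3
      (by rw [← map_add, ← map_add, diff_add_diff, diff_add_diff, diff_self, map_zero])
      inter_zero_three (inter_three _ (hσp k hk)) (inter_zero _ (hσp k hk)) n4.symm n5.symm n2
    exact ⟨c, h1, h2⟩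
  choose! c hA hB using hfactor
  have hpair : ∀ k ∈ pencil, ∀ l ∈ pencil, k ≠ l →
      c k = c l ∧ G (diff (lineA k) 1) = c k • diff (lineA (σ k)) 1 := by
    intro k hk l hl hkl
    have hne := hσ.ne hkl
    obtain ⟨k1, -, k3, k4, -⟩ := pencil_spec k hk
    obtain ⟨l1, -, l3, l4, -⟩ := pencil_spec l hl
    have nk := pencil_ne _ (hσp k hk)
    have nl := pencil_ne _ (hσp l hl)
    have nkl := lineA_ne _ (hσp k hk) _ (hσp l hl) hne
    have e3 := h 0 _ (diff_mem_localSpace l3 k3)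
    rw [h0] at e3
    obtain ⟨d, h1, -, hd⟩ := triangle (h k _ (diff_mem_localSpace k4 k1))
      (h l _ (diff_mem_localSpace l1 l4)) e3
      (by rw [← map_add, ← map_add, diff_add_diff, diff_add_diff, diff_self, map_zero])
      (inter_pencil _ (hσp k hk) _ (hσp l hl) hne)
      (fun t ht ht' => inter_zero _ (hσp l hl) t ht' ht)
      (fun t ht ht' => inter_zero _ (hσp k hk) t ht' ht)
      nl.1.symm nkl.symm nk.1
    rw [← diff_add_diff (lineA l) 3, map_add, hA l hl, ← neg_diff (lineA k), map_neg, hA k hk] at hd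
    have hk' := congrFun hd (lineA (σ k))
    have hl' := congrFun hd (lineA (σ l))
    simp [diff_apply, nkl, nkl.symm, nk.2.1, nl.2.1] at hk' hl'
    exact ⟨hk'.trans hl'.symm, by rw [h1, hk']⟩
  have hc : ∀ k ∈ pencil, c k = c 1 := fun k hk => by
    by_cases hk1 : k = 1
    · rw [hk1]
    · exact (hpair k hk 1 (by decide) hk1).1
  have h31 : G (diff 3 1) = c 1 • diff 3 1 := by
    rw [← diff_add_diff 3 (lineA 1) 1, ← neg_diff (lineA 1) 3, map_add, map_neg,
      hA 1 (by decide), (hpair 1 (by decide) 2 (by decide) (by decide)).2, ← smul_neg, neg_diff,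
      ← smul_add, diff_add_diff, neg_diff, diff_add_diff]
  refine ⟨c 1, fun h => ?_, h31, fun k hk => ⟨?_, ?_⟩⟩
  · rw [h, zero_smul] at h31
    exact hG.map_diff_ne_zero (by decide) h31
  · rw [← neg_diff, map_neg, hA k hk, hc k hk, ← smul_neg, neg_diff]
  · rw [hB k hk, hc k hk]

/-- The images of `diff 3 (lineC k)` allowed by resonance and by the values known so far. -/
theorem eq_smul_diff_of_resonant {k l : Fin 5} {c : ℤ} {a b : Fin 12 → ℤ} (hk : k ∈ pencil)
    (hl : l ∈ pencil) (hkl : k ≠ l) (hc : c ≠ 0) (ha : a - c • diff 3 1 ∈ localSpace (bigPoint k))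
    (hb : b - c • diff 3 1 ∈ localSpace (bigPoint l)) (h : Resonant a b) :
    ∃ x ∈ bigPoint k, a = c • diff 3 x ∧ (x = lineC k → (k = 1 ∧ l = 4) ∨ (k = 4 ∧ l = 1)) := by
  obtain ⟨k1, k3, -, -, -, -, kC, -⟩ := pencil_spec k hk
  obtain ⟨l1, l3, -⟩ := pencil_spec l hl
  have hsum := ha.1
  simp only [Pi.sub_apply, Pi.smul_apply, smul_eq_mul, Finset.sum_sub_distrib, ← Finset.mul_sum,
    sum_diff, mul_zero, sub_zero] at hsum
  have supp : ∀ {m : Fin 5} {f : Fin 12 → ℤ}, f - c • diff 3 1 ∈ localSpace (bigPoint m) →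
      1 ∈ bigPoint m → 3 ∉ bigPoint m → f 3 = c ∧ ∀ t ∉ bigPoint m, t ≠ 3 → f t = 0 := by
    intro m f hf h1 h3
    constructor
    · have := hf.2 3 h3
      simp [diff_apply] at this
      omega
    · intro t ht ht3
      have := hf.2 t ht
      have ht1 : t ≠ 1 := by rintro rfl; exact ht h1
      simpa [diff_apply, ht3, ht1] using this
  obtain ⟨ha3, ha0⟩ := supp ha k1 k3
  obtain ⟨hb3, hb0⟩ := supp hb l1 l3
  have total : ∀ {m : Fin 5} {f : Fin 12 → ℤ}, ∑ t, f t = 0 → f 3 = c → 3 ∉ bigPoint m →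
      (∀ t ∉ bigPoint m, t ≠ 3 → f t = 0) → ∑ t ∈ bigPoint m, f t = -c := by
    intro m f hf h3 h3m h0
    rw [← Finset.sum_subset (Finset.subset_univ (insert 3 (bigPoint m)))
      (fun t _ ht => by
        rw [Finset.mem_insert, not_or] at ht
        exact h0 t ht.2 ht.1), Finset.sum_insert h3m, h3] at hf
    omega
  have hatot := total hsum ha3 k3 ha0
  have join : ∀ {x : Fin 12} {P : Finset (Fin 12)}, 3 ∈ P → x ∈ P → x ∈ bigPoint k →
      (∀ t ∈ P, t ∈ bigPoint k → t = x) → ∑ t ∈ P, a t = c + a x := by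
    intro x P h3 hx hxk hP
    have hx3 : (3 : Fin 12) ≠ x := by rintro rfl; exact k3 hxk
    rw [← ha3]
    exact Finset.sum_eq_add 3 x hx3 (fun t ht h => ha0 t (fun h' => h.2 (hP t ht h')) h.1)
      (fun h => absurd h3 h) (fun h => absurd hx h)
  have bjoin : ∀ {x : Fin 12} {P : Finset (Fin 12)}, P ∈ calP → 3 ∈ P → x ∈ P → x ∈ bigPoint k →
      (∀ t ∈ P, t ∈ bigPoint k → t = x) → ∑ t ∈ P, b t = c + a x := by
    intro x P hP h3 hx hxk hPx
    have := h P hP 3 h3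
    rw [ha3, hb3, join h3 hx hxk hPx, mul_comm _ c] at this
    exact mul_left_cancel₀ hc this
  have hval : ∀ x ∈ bigPoint k, a x = 0 ∨ a x = -c := by
    intro x hx
    by_cases hx1 : x = 1
    · subst hx1
      have h13 : ({1, 3} : Finset (Fin 12)) ∈ calP := by simp [calP]
      have e1 := bjoin h13 (by decide) (by decide) hx (by
        intro t ht htk
        simp only [Finset.mem_insert, Finset.mem_singleton] at ht
        exact ht.resolve_right (by rintro rfl; exact k3 htk))
      rw [Finset.sum_pair (by decide), hb3] at e1
      have e2 : ∑ t ∈ bigPoint k, b t = b 1 :=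
        Finset.sum_eq_single 1 (fun t ht ht1 => hb0 t
          (fun h' => ht1 (inter_pencil k hk l hl hkl t ht h')) (by rintro rfl; exact k3 ht))
          (fun h => absurd k1 h)
      have e3 := h _ (bigPoint_mem k) 1 k1
      rw [e2, hatot] at e3
      have e4 : b 1 = a 1 := by omega
      rw [e4] at e3
      exact (mul_eq_mul_right_iff.1 e3).symm
    · obtain ⟨P, hP, h3, hxP, hPx⟩ := exists_join_three k hk x hx hx1
      have e1 := bjoin hP h3 hxP hx hPx
      have hbx : b x = 0 := hb0 x (fun h' => hx1 (inter_pencil k hk l hl hkl x hx h'))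
        (by rintro rfl; exact k3 hx)
      have e2 := h P hP x hxP
      rw [e1, hbx, mul_zero] at e2
      rcases mul_eq_zero.1 e2 with h' | h'
      · exact Or.inl h'
      · exact Or.inr (by omega)
  obtain ⟨x, hx, hax⟩ : ∃ x ∈ bigPoint k, a x ≠ 0 := by
    by_contra! h'
    rw [Finset.sum_eq_zero h'] at hatot
    omega
  have hrest : ∀ y ∈ bigPoint k, y ≠ x → a y = 0 := by
    have e1 := hatot
    rw [← Finset.add_sum_erase _ _ hx, (hval x hx).resolve_left hax] at e1
    have e2 : ∑ t ∈ (bigPoint k).erase x, c * a t = 0 := by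
      rw [← Finset.mul_sum, show ∑ t ∈ (bigPoint k).erase x, a t = 0 by omega, mul_zero]
    intro y hy hyx
    have e3 := (Finset.sum_eq_zero_iff_of_nonpos (fun t ht => ?_)).1 e2 y
      (Finset.mem_erase.2 ⟨hyx, hy⟩)
    · exact (mul_eq_zero.1 e3).resolve_left hc
    · rcases hval t (Finset.mem_of_mem_erase ht) with h' | h' <;> rw [h']
      · simp
      · nlinarith [mul_self_nonneg c]
  have hx3 : (3 : Fin 12) ≠ x := by rintro rfl; exact k3 hx
  refine ⟨x, hx, ?_, fun hxC => ?_⟩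
  · have := eq_smul_diff hx3 hsum fun t ht3 htx => by
      by_cases htk : t ∈ bigPoint k
      · exact hrest t htk htx
      · exact ha0 t htk ht3
    rwa [ha3] at this
  · rcases exists_join_three_lineC k hk l hl hkl with h' | h' | ⟨P, hP, h3, hxP, hPx, hPl⟩
    · exact Or.inl h'
    · exact Or.inr h'
    · exfalso
      rw [← hxC] at hxP hPx
      have e1 := bjoin hP h3 hxP hx hPx
      rw [Finset.sum_eq_single 3 (fun t ht ht3 => hb0 t (hPl t ht) ht3)
        (fun h => absurd h3 h), hb3] at e1
      omega

theorem PreservesResonance.eq_of_map_diff_eq (hG : PreservesResonance G) {x y : Fin 12}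
    (h : G (diff 3 x) = G (diff 3 y)) : x = y := by
  by_contra hne
  refine hG.map_diff_ne_zero hne ?_
  rw [← diff_add_diff x 3 y, map_add, ← h, ← neg_diff 3 x, map_neg, neg_add_cancel]

theorem PreservesResonance.map_diff_lineC (hG : PreservesResonance G) {c : ℤ}
    (hσp : ∀ k ∈ pencil, σ k ∈ pencil) (hσ : Function.Injective σ)
    (h : ∀ k, ∀ a ∈ localSpace (bigPoint k), G a ∈ localSpace (bigPoint (σ k)))
    (hc : c ≠ 0) (h1 : G (diff 3 1) = c • diff 3 1)
    (hAB : ∀ k ∈ pencil, G (diff 3 (lineA k)) = c • diff 3 (lineA (σ k)) ∧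
      G (diff 3 (lineB k)) = c • diff 3 (lineB (σ k))) {k l : Fin 5} (hk : k ∈ pencil)
    (hl : l ∈ pencil) (hkl : k ≠ l) (hP : {3, lineC k, lineC l} ∈ calP) :
    G (diff 3 (lineC k)) = c • diff 3 (lineC (σ k)) ∧
      ((σ k = 1 ∧ σ l = 4) ∨ (σ k = 4 ∧ σ l = 1)) := by
  have hmem : ∀ m ∈ pencil, G (diff 3 (lineC m)) - c • diff 3 1 ∈ localSpace (bigPoint (σ m)) := by
    intro m hm
    obtain ⟨m1, -, -, -, -, -, mC, -⟩ := pencil_spec m hm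
    rw [← h1, ← diff_add_diff 3 1 (lineC m), map_add, add_sub_cancel_left]
    exact h m _ (diff_mem_localSpace m1 mC)
  have hres := hG.resonant _ _ (sum_diff 3 (lineC k)) (sum_diff 3 (lineC l))
    (resonant_of_mem_localSpace hP (diff_mem_localSpace (by simp) (by simp))
      (diff_mem_localSpace (by simp) (by simp)))
  obtain ⟨x, hx, hGx, hxC⟩ := eq_smul_diff_of_resonant (hσp k hk) (hσp l hl) (hσ.ne hkl) hc
    (hmem k hk) (hmem l hl) hres
  obtain ⟨-, -, -, -, -, nA, nB, n1, -⟩ := pencil_ne k hk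
  have hx' : x = lineC (σ k) := by
    rcases (pencil_spec _ (hσp k hk)).2.2.2.2.2.2.2 x hx with rfl | rfl | rfl | rfl
    · exact absurd (hG.eq_of_map_diff_eq (hGx.trans (hAB k hk).1.symm)) nA
    · exact absurd (hG.eq_of_map_diff_eq (hGx.trans (hAB k hk).2.symm)) nB
    · exact absurd (hG.eq_of_map_diff_eq (hGx.trans h1.symm)) n1
    · rfl
  exact ⟨hx' ▸ hGx, hxC hx'⟩

theorem map_diff_of_map_diff_three {c : ℤ} {x y x' y' : Fin 12} (hx : G (diff 3 x) = c • diff 3 x')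
    (hy : G (diff 3 y) = c • diff 3 y') : G (diff x y) = c • diff x' y' := by
  rw [← diff_add_diff x 3 y, ← diff_add_diff x' 3 y', map_add, hy, ← neg_diff 3 x, map_neg, hx,
    ← smul_neg, neg_diff, smul_add]

theorem sub_smul_diff_mem {c : ℤ} {x y z : Fin 12} {x' y' : Fin 12}
    (hxy : G (diff x y) = c • diff x' y') (h : G (diff y z) ∈ localSpace P) :
    G (diff x z) - c • diff x' y' ∈ localSpace P := by
  rwa [← diff_add_diff x y z, map_add, hxy, add_sub_cancel_left]

theorem apply_of_sub_smul_diff_mem {c : ℤ} {x y t : Fin 12} {u : Fin 12 → ℤ}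
    (h : u - c • diff x y ∈ localSpace P) (ht : t ∉ P) : u t = c * diff x y t := by
  have := h.2 t ht
  rw [Pi.sub_apply, sub_eq_zero] at this
  exact this

theorem PreservesResonance.map_diff_six (hG : PreservesResonance G) {c : ℤ} (hc : c ≠ 0)
    (h : ∀ a ∈ localSpace (bigPoint 2), G a ∈ localSpace (bigPoint 2))
    (h1 : G (diff 0 1) = c • diff 0 1) (h10 : G (diff 0 10) = c • diff 0 10) :
    G (diff 0 6) = c • diff 0 6 := by
  have hloc := sub_smul_diff_mem h1
    (h _ (diff_mem_localSpace (by decide : (1 : Fin 12) ∈ bigPoint 2) (by decide : 6 ∈ bigPoint 2)))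
  have hP : ({0, 6, 10} : Finset (Fin 12)) ∈ calP := by simp [calP]
  have hres := hG.resonant _ _ (sum_diff 0 6) (sum_diff 0 10) (resonant_of_mem_localSpace hP
    (diff_mem_localSpace (by decide) (by decide)) (diff_mem_localSpace (by decide) (by decide)))
  rw [h10] at hres
  have e6 := hres.sum_eq_zero hc hP (by decide) (by decide) (by decide)
  have e1 := hres.sum_eq_apply hc (bigPoint_mem 1) (by decide) (by decide)
  have e4 := hres.sum_eq_apply hc (bigPoint_mem 0) (by decide) (by decide)
  have e2 := hres.sum_eq_apply hc (by simp [calP] : ({0, 2} : Finset (Fin 12)) ∈ calP)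
    (by decide) (by decide)
  have hval := fun t => apply_of_sub_smul_diff_mem (t := t) hloc
  generalize G (diff 0 6) = u at *
  have v0 := hval 0 (by decide)
  have v3 := hval 3 (by decide)
  have v5 := hval 5 (by decide)
  have v7 := hval 7 (by decide)
  have v8 := hval 8 (by decide)
  have v9 := hval 9 (by decide)
  have v10 := hval 10 (by decide)
  have v11 := hval 11 (by decide)
  simp [diff_apply] at v0 v3 v5 v7 v8 v9 v10 v11
  simp [bigPoint, v0, v3, v5, v8, v9, v10, v11] at e1 e2 e4 e6
  funext t
  fin_cases t <;> simp [diff_apply] <;> omega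

theorem PreservesResonance.map_diff_eight (hG : PreservesResonance G) {c : ℤ} (hc : c ≠ 0)
    (h : ∀ a ∈ localSpace (bigPoint 0), G a ∈ localSpace (bigPoint 0))
    (h3 : G (diff 2 3) = c • diff 2 3) (h10 : G (diff 2 10) = c • diff 2 10) :
    G (diff 2 8) = c • diff 2 8 := by
  have hloc := sub_smul_diff_mem h3
    (h _ (diff_mem_localSpace (by decide : (3 : Fin 12) ∈ bigPoint 0) (by decide : 8 ∈ bigPoint 0)))
  have hP : ({2, 8, 10} : Finset (Fin 12)) ∈ calP := by simp [calP]
  have hres := hG.resonant _ _ (sum_diff 2 8) (sum_diff 2 10) (resonant_of_mem_localSpace hP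
    (diff_mem_localSpace (by decide) (by decide)) (diff_mem_localSpace (by decide) (by decide)))
  rw [h10] at hres
  have e8 := hres.sum_eq_zero hc hP (by decide) (by decide) (by decide)
  have e4 := hres.sum_eq_apply hc (bigPoint_mem 2) (by decide) (by decide)
  have e3 := hres.sum_eq_apply hc (bigPoint_mem 3) (by decide) (by decide)
  have e0 := hres.sum_eq_apply hc (by simp [calP] : ({0, 2} : Finset (Fin 12)) ∈ calP)
    (by decide) (by decide)
  have e11 := hres.sum_eq_apply hc (by simp [calP] : ({2, 11} : Finset (Fin 12)) ∈ calP)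
    (by decide) (by decide)
  have hval := fun t => apply_of_sub_smul_diff_mem (t := t) hloc
  generalize G (diff 2 8) = u at *
  have v1 := hval 1 (by decide)
  have v2 := hval 2 (by decide)
  have v5 := hval 5 (by decide)
  have v6 := hval 6 (by decide)
  have v7 := hval 7 (by decide)
  have v9 := hval 9 (by decide)
  have v10 := hval 10 (by decide)
  simp [diff_apply] at v1 v2 v5 v6 v7 v9 v10
  simp [bigPoint, v1, v2, v5, v6, v7, v10] at e0 e3 e4 e8 e11
  funext t
  fin_cases t <;> simp [diff_apply] <;> omega

/-- The symmetry of the small configuration does not extend to the line `6`. -/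
theorem PreservesResonance.not_swap (hG : PreservesResonance G) {c : ℤ} (hc : c ≠ 0)
    (h : ∀ a ∈ localSpace (bigPoint 2), G a ∈ localSpace (bigPoint 2))
    (h1 : G (diff 0 1) = c • diff 11 1) (h10 : G (diff 0 10) = c • diff 11 9) : False := by
  have hloc := sub_smul_diff_mem h1
    (h _ (diff_mem_localSpace (by decide : (1 : Fin 12) ∈ bigPoint 2) (by decide : 6 ∈ bigPoint 2)))
  have hres := hG.resonant _ _ (sum_diff 0 6) (sum_diff 0 10) (resonant_of_mem_localSpace
    (by simp [calP] : ({0, 6, 10} : Finset (Fin 12)) ∈ calP)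
    (diff_mem_localSpace (by decide) (by decide)) (diff_mem_localSpace (by decide) (by decide)))
  rw [h10] at hres
  have e := hres.sum_eq_zero hc (by simp [calP] : ({9, 11} : Finset (Fin 12)) ∈ calP)
    (by decide) (by decide) (by decide)
  rw [Finset.sum_pair (by decide), apply_of_sub_smul_diff_mem hloc (by decide),
    apply_of_sub_smul_diff_mem hloc (by decide)] at e
  simp [diff_apply] at e
  exact hc e

/-- A linear map preserving resonance is a homothety on the vectors of sum zero. -/
theorem PreservesResonance.eq_smul (hG : PreservesResonance G) :
    ∃ c : ℤ, ∀ a, ∑ x, a x = 0 → G a = c • a := by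
  obtain ⟨σ, hσ, h0, h⟩ := hG.exists_perm
  have h3 := hG.perm_three_eq hσ h0 h
  have hσp : ∀ k ∈ pencil, σ k ∈ pencil := fun k hk => by
    refine perm_three _ (fun h' => ?_) fun h' => ?_
    · exact absurd (hσ (h'.trans h0.symm) ▸ hk) (by decide)
    · exact absurd (hσ (h'.trans h3.symm) ▸ hk) (by decide)
  obtain ⟨c, hc, h1, hAB⟩ := hG.exists_smul hσp hσ h0 h3 h
  obtain ⟨hC1, hσ14⟩ := hG.map_diff_lineC hσp hσ h hc h1 hAB (k := 1) (l := 4) (by decide)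
    (by decide) (by decide) (by simp [calP, lineC])
  obtain ⟨hC4, -⟩ := hG.map_diff_lineC hσp hσ h hc h1 hAB (k := 4) (l := 1) (by decide)
    (by decide) (by decide) (by
      rw [show ({3, lineC 4, lineC 1} : Finset (Fin 12)) = {3, 9, 10} by decide]
      simp [calP])
  have hσ2 : σ 2 = 2 := by
    have hp : ∀ s ∈ pencil, s ≠ 1 → s ≠ 4 → s = 2 := by decide
    have n1 : σ 2 ≠ σ 1 := hσ.ne (by decide)
    have n4 : σ 2 ≠ σ 4 := hσ.ne (by decide)
    rcases hσ14 with ⟨e1, e4⟩ | ⟨e1, e4⟩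
    · rw [e1] at n1
      rw [e4] at n4
      exact hp _ (hσp 2 (by decide)) n1 n4
    · rw [e1] at n1
      rw [e4] at n4
      exact hp _ (hσp 2 (by decide)) n4 n1
  obtain ⟨hA1, hB1⟩ := hAB 1 (by decide)
  obtain ⟨hA2, hB2⟩ := hAB 2 (by decide)
  obtain ⟨hA4, hB4⟩ := hAB 4 (by decide)
  have hbig0 := h 0
  have hbig2 := h 2
  rw [h0] at hbig0
  rw [hσ2] at hbig2 hA2 hB2
  rcases hσ14 with ⟨e1, e4⟩ | ⟨e1, e4⟩ <;> rw [e1] at hC1 hA1 hB1 <;> rw [e4] at hC4 hA4 hB4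
  · have h33 : G (diff 3 3) = c • diff 3 3 := by rw [diff_self, map_zero, smul_zero]
    have h6 := hG.map_diff_six hc hbig2 (map_diff_of_map_diff_three hA1 h1)
      (map_diff_of_map_diff_three hA1 hC4)
    have h8 := hG.map_diff_eight hc hbig0 (map_diff_of_map_diff_three hB2 h33)
      (map_diff_of_map_diff_three hB2 hC4)
    have hall : ∀ x, G (diff 3 x) = c • diff 3 x := by
      intro x
      fin_cases x
      · exact hA1
      · exact h1
      · exact hB2
      · exact h33
      · exact hA2
      · exact hB1
      · change G (diff 3 6) = c • diff 3 6
        rw [← diff_add_diff 3 0 6, map_add, h6, smul_add]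
        exact congrArg (· + _) hA1
      · exact hB4
      · change G (diff 3 8) = c • diff 3 8
        rw [← diff_add_diff 3 2 8, map_add, h8, smul_add]
        exact congrArg (· + _) hB2
      · exact hC1
      · exact hC4
      · exact hA4
    refine ⟨c, fun a ha => ?_⟩
    have : a = -∑ x, a x • diff 3 x := by
      funext t
      simp only [Pi.neg_apply, Finset.sum_apply, Pi.smul_apply, smul_eq_mul, diff_apply, mul_sub,
        Finset.sum_sub_distrib, ← Finset.sum_mul, ha]
      simp
    rw [this]
    simp only [map_neg, map_sum, map_smul, hall, smul_neg, Finset.smul_sum, smul_comm c]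
  · exact (hG.not_swap hc hbig2 (map_diff_of_map_diff_three hA1 h1)
      (map_diff_of_map_diff_three hA1 hC4)).elim

end Rigidity

section Forms

/-- The linear form on `H1` with value `a i` at `xL i`. -/
def form (a : Fin 12 → ℤ) (ha : ∑ x, a x = 0) : H1 →ₗ[ℤ] ℤ :=
  Submodule.liftQ _ (∑ i, a i • LinearMap.proj i) (by
    rw [Submodule.span_singleton_le_iff_mem, LinearMap.mem_ker]
    simpa using ha)

variable {a b : Fin 12 → ℤ}

theorem form_mk (ha : ∑ x, a x = 0) (v : Fin 12 → ℤ) :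
    form a ha (Submodule.Quotient.mk v) = ∑ i, a i * v i := by
  simp [form, Submodule.liftQ_apply]

theorem form_xL (ha : ∑ x, a x = 0) (i : Fin 12) : form a ha (xL i) = a i := by
  simp [xL, form_mk, Pi.single_apply]

theorem sum_xL : ∑ i, xL i = 0 := by
  have : ∑ i, xL i = Submodule.Quotient.mk (∑ i : Fin 12, Pi.single i (1 : ℤ)) :=
    (map_sum (Submodule.mkQ _) _ _).symm
  rw [this, Submodule.Quotient.mk_eq_zero, Finset.univ_sum_single]
  exact Submodule.mem_span_singleton_self _

theorem H1_hom_ext {M : Type*} [AddCommGroup M] {f g : H1 →+ M} (h : ∀ i, f (xL i) = g (xL i)) :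
    f = g := by
  ext x
  obtain ⟨v, rfl⟩ := Submodule.Quotient.mk_surjective _ x
  have : (Submodule.Quotient.mk v : H1) = ∑ i, v i • xL i := by
    have h1 := map_sum (Submodule.mkQ (Submodule.span ℤ {(fun _ => (1 : ℤ) : Fin 12 → ℤ)}))
      (fun i => v i • Pi.single i (1 : ℤ)) Finset.univ
    simp only [map_smul] at h1
    refine Eq.trans ?_ h1
    rw [Submodule.mkQ_apply]
    congr 1
    funext t
    simp [Pi.single_apply]
  rw [this, map_sum, map_sum]
  simp only [map_zsmul, h]

theorem eq_zero_of_form_eq_zero {x : H1} (h : ∀ a ha, form a ha x = 0) : x = 0 := by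
  obtain ⟨v, rfl⟩ := Submodule.Quotient.mk_surjective _ x
  rw [Submodule.Quotient.mk_eq_zero, Submodule.mem_span_singleton]
  refine ⟨v 0, funext fun t => ?_⟩
  have := h _ (sum_diff 0 t)
  simp only [form_mk, diff_apply, sub_mul, ite_mul, one_mul, zero_mul, Finset.sum_sub_distrib,
    Finset.sum_ite_eq', Finset.mem_univ, if_true] at this
  simp
  omega

/-- The wedge product of two linear forms, as a linear form on the exterior algebra. -/
noncomputable def wedgeForm (A B : H1 →ₗ[ℤ] ℤ) : ExteriorAlgebra ℤ H1 →ₗ[ℤ] ℤ :=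
  ExteriorAlgebra.liftAlternating
    (Pi.single 2 (Matrix.detRowAlternating.compLinearMap (LinearMap.pi ![A, B])))

theorem wedgeForm_wedge (A B : H1 →ₗ[ℤ] ℤ) (x y : H1) :
    wedgeForm A B (wedge x y) = A x * B y - B x * A y := by
  have : wedge x y = ExteriorAlgebra.ιMulti ℤ 2 ![x, y] := by
    simp [wedge, ExteriorAlgebra.ιMulti_apply]
  rw [this, wedgeForm, ExteriorAlgebra.liftAlternating_apply_ιMulti, Pi.single_eq_same,
    AlternatingMap.compLinearMap_apply]
  exact Matrix.det_fin_two _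

theorem Resonant.wedgeForm_eq_zero (h : Resonant a b) (ha : ∑ x, a x = 0) (hb : ∑ x, b x = 0) :
    ∀ w ∈ H2, wedgeForm (form a ha) (form b hb) w = 0 := by
  intro w hw
  induction hw using AddSubgroup.closure_induction with
  | mem w hw =>
    obtain ⟨P, hP, L, hL, rfl⟩ := hw
    rw [wedgeForm_wedge, xP, map_sum, map_sum]
    simp only [form_xL]
    rw [h P hP L hL, mul_comm, sub_self]
  | zero => exact map_zero _
  | add _ _ _ _ h1 h2 => rw [map_add, h1, h2, add_zero]
  | neg _ _ h1 => rw [map_neg, h1, neg_zero]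

/-- A matrix of lifts of the images of the generators represents the transpose of `ρ`. -/
theorem exists_transpose (ρ : H1 ≃+ H1) : ∃ G : (Fin 12 → ℤ) →ₗ[ℤ] (Fin 12 → ℤ),
    ∀ a ha i, G a i = form a ha (ρ (xL i)) := by
  choose r hr using fun i => Submodule.Quotient.mk_surjective _ (ρ (xL i))
  refine ⟨Matrix.mulVecLin (Matrix.of r), fun a ha i => ?_⟩
  rw [← hr, form_mk]
  simp [Matrix.mulVec, dotProduct, mul_comm]

theorem preservesResonance_transpose {ρ : H1 ≃+ H1}
    (h : ∀ w ∈ H2, ExteriorAlgebra.map ρ.toAddMonoidHom.toIntLinearMap w ∈ H2)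
    {G : (Fin 12 → ℤ) →ₗ[ℤ] (Fin 12 → ℤ)} (hG : ∀ a ha i, G a i = form a ha (ρ (xL i))) :
    PreservesResonance G where
  sum_eq_zero a ha := by
    simp only [hG a ha]
    rw [← map_sum, ← map_sum, sum_xL, map_zero, map_zero]
  eq_zero a ha h0 := by
    have h1 : (form a ha).toAddMonoidHom.comp ρ.toAddMonoidHom = 0 :=
      H1_hom_ext fun i => (hG a ha i).symm.trans (congrFun h0 i)
    funext i
    rw [← form_xL ha i, ← ρ.apply_symm_apply (xL i)]
    exact DFunLike.congr_fun h1 _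
  resonant a b ha hb hab P hP L hL := by
    have h1 := hab.wedgeForm_eq_zero ha hb _
      (h _ (AddSubgroup.subset_closure ⟨P, hP, L, hL, rfl⟩))
    have h2 : ExteriorAlgebra.map ρ.toAddMonoidHom.toIntLinearMap (wedge (xL L) (xP P)) =
        wedge (ρ (xL L)) (∑ K ∈ P, ρ (xL K)) := by
      rw [wedge, map_mul, ExteriorAlgebra.map_apply_ι, ExteriorAlgebra.map_apply_ι, ← map_sum]
      rfl
    rw [h2, wedgeForm_wedge, map_sum, map_sum, sub_eq_zero] at h1
    simp only [hG a ha, hG b hb]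
    rw [h1, mul_comm]

end Forms

/-- Homological rigidity of `𝒜G`: a group automorphism `ρ` of `H₁` whose induced
automorphism `ρ∧ρ` maps `H₂` into `H₂` is `±` the identity. -/
theorem statement3 (ρ : H1 ≃+ H1)
    (h : ∀ w ∈ H2, ExteriorAlgebra.map ρ.toAddMonoidHom.toIntLinearMap w ∈ H2) :
    (∀ x, ρ x = x) ∨ (∀ x, ρ x = -x) := by
  obtain ⟨G, hG⟩ := exists_transpose ρ
  obtain ⟨c, hc⟩ := (preservesResonance_transpose h hG).eq_smul
  have hρ : ∀ x, ρ x = c • x := by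
    intro x
    rw [← sub_eq_zero]
    refine eq_zero_of_form_eq_zero fun a ha => ?_
    have h1 : (form a ha).toAddMonoidHom.comp ρ.toAddMonoidHom = c • (form a ha).toAddMonoidHom :=
      H1_hom_ext fun i => by
        have := hG a ha i
        rw [hc a ha, Pi.smul_apply] at this
        rw [← form_xL ha i] at this
        exact this.symm
    rw [map_sub, map_zsmul, sub_eq_zero]
    exact DFunLike.congr_fun h1 x
  have h1 : c * form (diff 0 1) (sum_diff 0 1) (ρ.symm (xL 0)) = 1 := by
    rw [← smul_eq_mul, ← map_zsmul, ← hρ, ρ.apply_symm_apply, form_xL]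
    decide
  rcases Int.eq_one_or_neg_one_of_mul_eq_one h1 with rfl | rfl
  · exact Or.inl fun x => by rw [hρ, one_smul]
  · exact Or.inr fun x => by rw [hρ, neg_smul, one_smul]
end

section
/- The only bijection σ of {1,…,12} such that σ(P) ∈ 𝒫 for every P ∈ 𝒫 (where σ(P) denotes the image set) is the identity; that is, the automorphism group of the combinatorics 𝒜G is trivial. -/
/-- The number of points of `calP` of cardinality `k` that contain all the lines in `A`. -/
def pointCount (A : Finset (Fin 12)) (k : ℕ) : ℕ :=
  (calP.filter fun P => A ⊆ P ∧ P.card = k).card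

theorem image_calP_of_forall_image_mem {σ : Equiv.Perm (Fin 12)}
    (h : ∀ P ∈ calP, P.image σ ∈ calP) : calP.image (Finset.image σ) = calP :=
  Finset.eq_of_subset_of_card_le (Finset.image_subset_iff.2 h)
    (Finset.card_image_of_injective _ (Finset.image_injective σ.injective)).ge

theorem pointCount_image {σ : Equiv.Perm (Fin 12)} (h : ∀ P ∈ calP, P.image σ ∈ calP)
    (A : Finset (Fin 12)) (k : ℕ) : pointCount (A.image σ) k = pointCount A k := by
  unfold pointCount
  conv_lhs => rw [← image_calP_of_forall_image_mem h]
  rw [Finset.filter_image, Finset.card_image_of_injective _ (Finset.image_injective σ.injective)]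
  simp only [Finset.image_subset_image_iff σ.injective,
    Finset.card_image_of_injective _ σ.injective]

/-- The lines `1`, `8`, `10`, `11` are determined by the sizes of the points they contain. -/
theorem eq_of_pointCount_singleton_eq : ∀ a ∈ ({1, 8, 10, 11} : Finset (Fin 12)), ∀ i,
    (∀ k ∈ Finset.Icc 2 4, pointCount {i} k = pointCount {a} k) → i = a := by
  decide +kernel

/-- A line is determined by the sizes of the points it contains together with the sizes of its
intersection points with the lines `1`, `8`, `10`, `11`. -/
theorem eq_of_pointCount_pair_eq : ∀ i j : Fin 12,
    (∀ k ∈ Finset.Icc 2 4, pointCount {i} k = pointCount {j} k) →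
    (∀ a ∈ ({1, 8, 10, 11} : Finset (Fin 12)), ∀ k ∈ Finset.Icc 2 4,
      pointCount {i, a} k = pointCount {j, a} k) → i = j := by
  decide +kernel

/-- The only bijection of the twelve lines preserving the point set `𝒫` of the
combinatorics `𝒜G` is the identity: the automorphism group of `𝒜G` is trivial. -/
theorem statement4 (σ : Equiv.Perm (Fin 12)) (h : ∀ P ∈ calP, P.image σ ∈ calP) :
    σ = 1 := by
  have single (i : Fin 12) (k : ℕ) : pointCount {σ i} k = pointCount {i} k := by
    simpa using pointCount_image h {i} k
  ext1 i
  refine eq_of_pointCount_pair_eq _ _ (fun k _ => single i k) fun a ha k _ => ?_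
  have fixed : σ a = a := eq_of_pointCount_singleton_eq a ha _ fun k _ => single a k
  simpa [Finset.image_insert, fixed] using pointCount_image h {i, a} k
end

section
/- The group of all bijections σ of {1,…,11} such that σ(P) ∈ 𝒫' for every P ∈ 𝒫' is cyclic of order 4, generated by the permutation (1 2 3 4)(7 8 9 10)(5 6) which fixes 11. -/
/-- The point set `𝒫'` of the combinatorics `𝒜~G`, on the line set `Fin 11`
(index `i : Fin 11` corresponds to the line numbered `i+1`). -/
def calP' : Finset (Finset (Fin 11)) :=
  { {0, 3, 4, 8}, {0, 1, 5, 9}, {1, 2, 4, 6}, {2, 3, 5, 7}, {1, 7, 10},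
    {0, 6, 10}, {2, 8, 10}, {3, 9, 10}, {4, 7, 9}, {5, 6, 8},
    {4, 5}, {4, 10}, {5, 10}, {0, 2}, {1, 3}, {0, 7}, {1, 8}, {2, 9}, {3, 6},
    {6, 7}, {6, 9}, {7, 8}, {8, 9} }

/-- The permutation `(1 2 3 4)(7 8 9 10)(5 6)` of the eleven lines (0-indexed:
`(0 1 2 3)(6 7 8 9)(4 5)`, fixing `10`). -/
def g : Equiv.Perm (Fin 11) where
  toFun := ![1, 2, 3, 0, 5, 4, 7, 8, 9, 6, 10]
  invFun := ![3, 0, 1, 2, 5, 4, 9, 6, 7, 8, 10]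
  left_inv := by decide
  right_inv := by decide

/-- The generator preserves the point set. -/
lemma g_preserves_calP' : ∀ P ∈ calP', P.image g ∈ calP' := by
  decide +kernel

lemma orderOf_g : orderOf g = 4 := by
  have h : orderOf g = 2 ^ (1 + 1) :=
    orderOf_eq_prime_pow (by decide +kernel) (by decide +kernel)
  simpa using h

set_option synthInstance.maxSize 4096 in
/-- A tuple of lines which respects a suitable subset of the incidences of `𝒫'` is the tuple of
values of a power of `g`. The lines are listed so that the double points cut the search down
to the four-cycles of the graph of double points first. -/
lemma eq_pow_g_of_incidences : ∀ a₆ a₇ : Fin 11, {a₆, a₇} ∈ calP' →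
    ∀ a₈, {a₇, a₈} ∈ calP' → a₆ ≠ a₈ →
    ∀ a₉, {a₈, a₉} ∈ calP' → {a₆, a₉} ∈ calP' → a₇ ≠ a₉ →
    ∀ a₀, {a₀, a₇} ∈ calP' → a₀ ≠ a₆ → a₀ ≠ a₈ →
    ∀ a₂, {a₂, a₉} ∈ calP' → {a₀, a₂} ∈ calP' →
    ∀ a₁, {a₁, a₈} ∈ calP' → a₁ ≠ a₇ → a₁ ≠ a₉ →
    ∀ a₃, {a₃, a₆} ∈ calP' → {a₁, a₃} ∈ calP' →
    ∀ a₁₀, {a₀, a₆, a₁₀} ∈ calP' → a₁₀ ≠ a₀ → a₁₀ ≠ a₆ →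
    ∀ a₄, {a₄, a₁₀} ∈ calP' → {a₀, a₃, a₄, a₈} ∈ calP' →
    ∀ a₅, {a₄, a₅} ∈ calP' → a₅ ≠ a₁₀ →
    ∃ k : Fin 4, ∀ i : Fin 11, ![a₀, a₁, a₂, a₃, a₄, a₅, a₆, a₇, a₈, a₉, a₁₀] i = (g ^ (k : ℕ)) i := by
  decide +kernel

lemma mem_zpowers_g_of_preserves {σ : Equiv.Perm (Fin 11)}
    (h : ∀ P ∈ calP', P.image σ ∈ calP') : σ ∈ Subgroup.zpowers g := by
  have double (a b : Fin 11) (hab : {a, b} ∈ calP') : {σ a, σ b} ∈ calP' := by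
    simpa [Finset.image_insert] using h _ hab
  have ne (a b : Fin 11) (hab : a ≠ b) : σ a ≠ σ b := σ.injective.ne hab
  have triple : {σ 0, σ 6, σ 10} ∈ calP' := by
    simpa [Finset.image_insert] using h {0, 6, 10} (by decide)
  have quadruple : {σ 0, σ 3, σ 4, σ 8} ∈ calP' := by
    simpa [Finset.image_insert] using h {0, 3, 4, 8} (by decide)
  obtain ⟨k, hk⟩ := eq_pow_g_of_incidences (σ 6) (σ 7) (double _ _ (by decide))
    (σ 8) (double _ _ (by decide)) (ne _ _ (by decide))
    (σ 9) (double _ _ (by decide)) (double _ _ (by decide)) (ne _ _ (by decide))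
    (σ 0) (double _ _ (by decide)) (ne _ _ (by decide)) (ne _ _ (by decide))
    (σ 2) (double _ _ (by decide)) (double _ _ (by decide))
    (σ 1) (double _ _ (by decide)) (ne _ _ (by decide)) (ne _ _ (by decide))
    (σ 3) (double _ _ (by decide)) (double _ _ (by decide))
    (σ 10) triple (ne _ _ (by decide)) (ne _ _ (by decide))
    (σ 4) (double _ _ (by decide)) quadruple
    (σ 5) (double _ _ (by decide)) (ne _ _ (by decide))
  have hσ : σ = g ^ (k : ℕ) := by
    ext i
    rw [← hk i]
    fin_cases i <;> rfl
  exact hσ ▸ Subgroup.npow_mem_zpowers g k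

/-- The group of bijections of the eleven lines preserving the point set `𝒫'` of `𝒜~G`
is cyclic of order `4`, generated by `(1 2 3 4)(7 8 9 10)(5 6)`. -/
theorem statement5 :
    (∀ σ : Equiv.Perm (Fin 11),
      (∀ P ∈ calP', P.image σ ∈ calP') ↔ σ ∈ Subgroup.zpowers g) ∧
    orderOf g = 4 := by
  refine ⟨fun σ => ⟨mem_zpowers_g_of_preserves, fun hσ => ?_⟩, orderOf_g⟩
  obtain ⟨k, -, rfl⟩ := mem_zpowers_iff_mem_range_orderOf.mp hσ |> Finset.mem_image.mp
  induction k with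
  | zero => simp
  | succ k ih =>
    intro P hP
    have hk : P.image (g ^ k) ∈ calP' := ih (Subgroup.npow_mem_zpowers g k) P hP
    simpa only [Finset.image_image, pow_succ', Equiv.Perm.coe_mul] using
      g_preserves_calP' _ hk
end

section
/- With the quadrangle configuration as in the context, suppose P₅ ∈ L₅ and P₆ ∈ L₆ do not lie on L₁∪L₂∪L₃∪L₄, and suppose the four intersection points Q₁, Q₂, Q₃, Q₄ are pairwise distinct. Then Q₁, Q₂, Q₃, Q₄ are collinear if and only if there exists a primitive fifth root of unity ζ (with ζ̄=ζ⁻¹) such that L₇, L₈, L₉, L₁₀ are respectively the lines x−(ζ̄²+ζ̄)y−(ζ²+ζ)z=0, x+(ζ̄+ζ²)y−(ζ̄²+ζ)z=0, x+(ζ²+ζ)y+(ζ̄²+ζ̄)z=0, x−(ζ̄²+ζ)y+(ζ̄+ζ²)z=0. In particular there are exactly four such pairs (P₅,P₆). -/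
open scoped LinearAlgebra.Projectivization
open Projectivization

abbrev P2 : Type := ℙ ℂ (Fin 3 → ℂ)

/-- The projective line `{[x:y:z] | v₀x + v₁y + v₂z = 0}` in `ℙ²(ℂ)`. -/
def lineOf (v : Fin 3 → ℂ) : Set P2 :=
  {p | v 0 * p.rep 0 + v 1 * p.rep 1 + v 2 * p.rep 2 = 0}

/-- The projective line through two points `p, q` of `ℙ²(ℂ)`. -/
def lineThrough (p q : P2) : Set P2 :=
  {r | r.rep ∈ Submodule.span ℂ ({p.rep, q.rep} : Set (Fin 3 → ℂ))}

/-- Homogeneous coordinates of the points `P₁ = [1:1:1]`, `P₂ = [1:−1:1]`,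
`P₃ = [1:−1:−1]`, `P₄ = [1:1:−1]`. -/
def quadVec : Fin 4 → Fin 3 → ℂ :=
  ![![1, 1, 1], ![1, -1, 1], ![1, -1, -1], ![1, 1, -1]]

lemma quadVec_ne_zero (i : Fin 4) : quadVec i ≠ 0 := by
  intro h
  have h1 : quadVec i 0 = 1 := by fin_cases i <;> rfl
  rw [h, Pi.zero_apply] at h1
  exact zero_ne_one h1

/-- The points `P₁, P₂, P₃, P₄` of the quadrangle. -/
noncomputable def ptP (i : Fin 4) : P2 :=
  Projectivization.mk ℂ (quadVec i) (quadVec_ne_zero i)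

/-- Coefficients of the quadrangle lines `L₁: x−z`, `L₂: x+y`, `L₃: x+z`, `L₄: x−y`. -/
def qc : Fin 4 → Fin 3 → ℂ :=
  ![![1, 0, -1], ![1, 1, 0], ![1, 0, 1], ![1, -1, 0]]

/-- The lines `L₇ = P₃P₆`, `L₈ = P₄P₅`, `L₉ = P₁P₆`, `L₁₀ = P₂P₅` determined by a choice
of `P₅ ∈ L₅` and `P₆ ∈ L₆`; index `i : Fin 4` corresponds to `L_{i+7}`. -/
noncomputable def auxLine (p5 p6 : P2) : Fin 4 → Set P2 :=
  ![lineThrough (ptP 2) p6, lineThrough (ptP 3) p5,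
    lineThrough (ptP 0) p6, lineThrough (ptP 1) p5]

/-- Coefficients of the candidate lines `L₇, L₈, L₉, L₁₀` attached to a primitive fifth
root of unity `ζ` (with `ζ̄ = ζ⁻¹`); index `i : Fin 4` corresponds to `L_{i+7}`. -/
noncomputable def newCoeffs (ζ : ℂ) : Fin 4 → Fin 3 → ℂ :=
  ![![1, -(ζ⁻¹ ^ 2 + ζ⁻¹), -(ζ ^ 2 + ζ)],
    ![1, ζ⁻¹ + ζ ^ 2, -(ζ⁻¹ ^ 2 + ζ)],
    ![1, ζ ^ 2 + ζ, ζ⁻¹ ^ 2 + ζ⁻¹],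
    ![1, -(ζ⁻¹ ^ 2 + ζ), ζ⁻¹ + ζ ^ 2]]

/-- A pair `(P₅, P₆)` satisfying the full configuration: `P₅ ∈ L₅`, `P₆ ∈ L₆`, both off
the quadrangle lines, the four intersection points `Q_i = L_i ∩ L_{i+6}` exist and are
pairwise distinct, and `Q₁, Q₂, Q₃, Q₄` are collinear. -/
def GoodPair (p5 p6 : P2) : Prop :=
  p5 ∈ lineOf ![0, 1, -1] ∧ p6 ∈ lineOf ![0, 1, 1] ∧
  (∀ i : Fin 4, p5 ∉ lineOf (qc i) ∧ p6 ∉ lineOf (qc i)) ∧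
  ∃ q : Fin 4 → P2, Function.Injective q ∧
    (∀ i : Fin 4, lineOf (qc i) ∩ auxLine p5 p6 i = {q i}) ∧
    ∃ v : Fin 3 → ℂ, v ≠ 0 ∧ ∀ i : Fin 4, q i ∈ lineOf v

open scoped Matrix

theorem mk_mem_lineOf_iff {v : Fin 3 → ℂ} (hv : v ≠ 0) (w : Fin 3 → ℂ) :
    Projectivization.mk ℂ v hv ∈ lineOf w ↔ w ⬝ᵥ v = 0 := by
  obtain ⟨a, ha⟩ := Projectivization.exists_smul_eq_mk_rep ℂ v hv
  have key : w 0 * (a • v) 0 + w 1 * (a • v) 1 + w 2 * (a • v) 2 = (a : ℂ) * (w ⬝ᵥ v) := by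
    simp only [Pi.smul_apply, Units.smul_def, smul_eq_mul, dotProduct, Fin.sum_univ_three]
    ring
  rw [lineOf, Set.mem_ofPred_eq, ← ha, key, mul_eq_zero, or_iff_right a.ne_zero]

theorem mem_lineOf_iff_dotProduct_rep (p : P2) (w : Fin 3 → ℂ) :
    p ∈ lineOf w ↔ w ⬝ᵥ p.rep = 0 := by
  simp [lineOf, dotProduct, Fin.sum_univ_three]

theorem lineOf_smul {k : ℂ} (hk : k ≠ 0) (w : Fin 3 → ℂ) : lineOf (k • w) = lineOf w := by
  ext p
  simp [mem_lineOf_iff_dotProduct_rep, hk]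

theorem mem_span_pair_iff_of_crossProduct_ne_zero {u v : Fin 3 → ℂ} (h : u ⨯₃ v ≠ 0)
    (r : Fin 3 → ℂ) : r ∈ Submodule.span ℂ {u, v} ↔ (u ⨯₃ v) ⬝ᵥ r = 0 := by
  rw [Submodule.mem_span_pair]
  constructor
  · rintro ⟨a, b, rfl⟩
    simp only [cross_apply, dotProduct, Fin.sum_univ_three, Pi.add_apply, Pi.smul_apply,
      smul_eq_mul, Matrix.cons_val]
    ring
  · intro hr
    obtain ⟨i, hi⟩ := Function.ne_iff.mp h
    refine ⟨(r ⨯₃ v) i / (u ⨯₃ v) i, (u ⨯₃ r) i / (u ⨯₃ v) i, ?_⟩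
    ext j
    rw [Pi.zero_apply] at hi
    rw [Pi.add_apply, Pi.smul_apply, Pi.smul_apply, smul_eq_mul, smul_eq_mul, div_mul_eq_mul_div,
      div_mul_eq_mul_div, ← add_div, div_eq_iff hi]
    simp only [cross_apply, dotProduct, Fin.sum_univ_three, Matrix.cons_val] at hr
    fin_cases i <;> fin_cases j <;>
      simp only [cross_apply, Fin.mk_zero, Fin.mk_one, Fin.reduceFinMk,
        Matrix.cons_val] <;>
      first | ring1 | linear_combination hr | linear_combination -hr

theorem lineThrough_mk {u v : Fin 3 → ℂ} (hu : u ≠ 0) (hv : v ≠ 0) (h : u ⨯₃ v ≠ 0) :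
    lineThrough (Projectivization.mk ℂ u hu) (Projectivization.mk ℂ v hv) =
      lineOf (u ⨯₃ v) := by
  obtain ⟨a, ha⟩ := Projectivization.exists_smul_eq_mk_rep ℂ u hu
  obtain ⟨b, hb⟩ := Projectivization.exists_smul_eq_mk_rep ℂ v hv
  have hab : ((a • u) ⨯₃ (b • v)) = ((a : ℂ) * b) • (u ⨯₃ v) := by
    simp [Units.smul_def, smul_smul, mul_comm]
  have hab0 : (a : ℂ) * b ≠ 0 := mul_ne_zero a.ne_zero b.ne_zero
  ext r
  rw [← lineOf_smul hab0, ← hab, mem_lineOf_iff_dotProduct_rep,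
    ← mem_span_pair_iff_of_crossProduct_ne_zero (by rw [hab]; exact smul_ne_zero hab0 h), ha, hb]
  rfl

theorem lineOf_inter_lineOf {u v : Fin 3 → ℂ} (h : u ⨯₃ v ≠ 0) :
    lineOf u ∩ lineOf v = {Projectivization.mk ℂ (u ⨯₃ v) h} := by
  ext p
  rw [Set.mem_singleton_iff]
  constructor
  · rintro ⟨h1, h2⟩
    rw [mem_lineOf_iff_dotProduct_rep] at h1 h2
    rw [← p.mk_rep, Projectivization.mk_eq_mk_iff_crossProduct_eq_zero]
    rw [cross_cross_eq_smul_sub_smul']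
    simp [h1, h2, dotProduct_comm]
  · rintro rfl
    exact ⟨(mk_mem_lineOf_iff h u).mpr (dot_self_cross u v),
      (mk_mem_lineOf_iff h v).mpr (dot_cross_self u v)⟩

/-- The point `[a : b : b]` of `L₅`. -/
noncomputable def ptFive (a b : ℂ) (h : a ^ 2 ≠ b ^ 2) : P2 :=
  Projectivization.mk ℂ ![a, b, b] fun h0 => h <| by
    have h1 : a = 0 := congrFun h0 0
    have h2 : b = 0 := congrFun h0 1
    rw [h1, h2]

/-- The point `[c : d : -d]` of `L₆`. -/
noncomputable def ptSix (c d : ℂ) (h : c ^ 2 ≠ d ^ 2) : P2 :=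
  Projectivization.mk ℂ ![c, d, -d] fun h0 => h <| by
    have h1 : c = 0 := congrFun h0 0
    have h2 : d = 0 := congrFun h0 1
    rw [h1, h2]

/-- Coefficients of the lines `L₇, …, L₁₀` for `P₅ = [a : b : b]`, `P₆ = [c : d : -d]`. -/
def auxVec (a b c d : ℂ) : Fin 4 → Fin 3 → ℂ :=
  ![![2 * d, d - c, d + c], ![2 * b, -a - b, b - a],
    ![-2 * d, c + d, d - c], ![-2 * b, a - b, a + b]]

theorem exists_ptFive {p : P2} (h5 : p ∈ lineOf ![0, 1, -1]) (h : ∀ i, p ∉ lineOf (qc i)) :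
    ∃ a b, ∃ hab : a ^ 2 ≠ b ^ 2, p = ptFive a b hab := by
  have h5' : p.rep 2 = p.rep 1 := by
    simp [lineOf] at h5
    linear_combination -h5
  have h1 : ¬ p.rep 0 + p.rep 1 = 0 := by simpa [lineOf, qc] using h 1
  have h3 : ¬ p.rep 0 + -p.rep 1 = 0 := by simpa [lineOf, qc] using h 3
  refine ⟨p.rep 0, p.rep 1, fun h' => mul_ne_zero h1 h3 (by linear_combination h'), ?_⟩
  conv_lhs => rw [← p.mk_rep]
  unfold ptFive
  congr 1
  ext i
  fin_cases i <;> simp [h5']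

theorem exists_ptSix {p : P2} (h6 : p ∈ lineOf ![0, 1, 1]) (h : ∀ i, p ∉ lineOf (qc i)) :
    ∃ c d, ∃ hcd : c ^ 2 ≠ d ^ 2, p = ptSix c d hcd := by
  have h6' : p.rep 2 = -p.rep 1 := by
    simp [lineOf] at h6
    linear_combination h6
  have h1 : ¬ p.rep 0 + p.rep 1 = 0 := by simpa [lineOf, qc] using h 1
  have h3 : ¬ p.rep 0 + -p.rep 1 = 0 := by simpa [lineOf, qc] using h 3
  refine ⟨p.rep 0, p.rep 1, fun h' => mul_ne_zero h1 h3 (by linear_combination h'), ?_⟩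
  conv_lhs => rw [← p.mk_rep]
  unfold ptSix
  congr 1
  ext i
  fin_cases i <;> simp [h6']

section Configuration

variable {a b c d : ℂ}

theorem sub_ne_zero_of_sq_ne_sq (h : a ^ 2 ≠ b ^ 2) : a - b ≠ 0 :=
  fun h' => h (by linear_combination (a + b) * h')

theorem add_ne_zero_of_sq_ne_sq (h : a ^ 2 ≠ b ^ 2) : a + b ≠ 0 :=
  fun h' => h (by linear_combination (a - b) * h')

theorem ptFive_congr {a' b' : ℂ} (hab : a ^ 2 ≠ b ^ 2) (hab' : a' ^ 2 ≠ b' ^ 2) :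
    ptFive a b hab = ptFive a' b' hab' ↔ a * b' = a' * b := by
  rw [ptFive, ptFive, Projectivization.mk_eq_mk_iff_crossProduct_eq_zero]
  constructor
  · intro h
    have h2 := congrFun h 2
    simp [cross_apply] at h2
    linear_combination h2
  · intro h
    ext i
    fin_cases i <;> simp [cross_apply] <;> grind

theorem ptSix_congr {c' d' : ℂ} (hcd : c ^ 2 ≠ d ^ 2) (hcd' : c' ^ 2 ≠ d' ^ 2) :
    ptSix c d hcd = ptSix c' d' hcd' ↔ c * d' = c' * d := by
  rw [ptSix, ptSix, Projectivization.mk_eq_mk_iff_crossProduct_eq_zero]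
  constructor
  · intro h
    have h2 := congrFun h 2
    simp [cross_apply] at h2
    linear_combination h2
  · intro h
    ext i
    fin_cases i <;> simp [cross_apply] <;> grind

theorem auxLine_ptFive_ptSix (hab : a ^ 2 ≠ b ^ 2) (hcd : c ^ 2 ≠ d ^ 2) (i : Fin 4) :
    auxLine (ptFive a b hab) (ptSix c d hcd) i = lineOf (auxVec a b c d i) := by
  have line_eq {u v w : Fin 3 → ℂ} (hu : u ≠ 0) (hv : v ≠ 0) (h : u ⨯₃ v = w) {j : Fin 3}
      (hj : w j ≠ 0) : lineThrough (Projectivization.mk ℂ u hu) (Projectivization.mk ℂ v hv) =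
        lineOf w := by
    subst h
    exact lineThrough_mk hu hv (Function.ne_iff.mpr ⟨j, hj⟩)
  have h1 := sub_ne_zero_of_sq_ne_sq hab
  have h2 := add_ne_zero_of_sq_ne_sq hab
  have h3 := sub_ne_zero_of_sq_ne_sq hcd
  have h4 := add_ne_zero_of_sq_ne_sq hcd
  fin_cases i
  · refine line_eq (j := 2) _ _ ?_ (by simpa [auxVec, add_comm] using h4)
    ext k
    fin_cases k <;> simp [cross_apply, quadVec, auxVec] <;> ring
  · refine line_eq (j := 2) _ _ ?_ (by simpa [auxVec, sub_eq_zero, eq_comm] using h1)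
    ext k
    fin_cases k <;> simp [cross_apply, quadVec, auxVec] <;> ring
  · refine line_eq (j := 1) _ _ ?_ (by simpa [auxVec] using h4)
    ext k
    fin_cases k <;> simp [cross_apply, quadVec, auxVec] <;> ring
  · refine line_eq (j := 2) _ _ ?_ (by simpa [auxVec] using h2)
    ext k
    fin_cases k <;> simp [cross_apply, quadVec, auxVec] <;> ring

theorem cross_qc_auxVec (i : Fin 4) : qc i ⨯₃ auxVec a b c d i =
    (![![d - c, -(3 * d + c), d - c], ![b - a, a - b, -(a + 3 * b)],
      ![-(c + d), c - 3 * d, c + d], ![-(a + b), -(a + b), a - 3 * b]] : Fin 4 → Fin 3 → ℂ) i := by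
  ext k
  fin_cases i <;> fin_cases k <;> simp [cross_apply, qc, auxVec] <;> ring

theorem cross_qc_auxVec_ne_zero (hab : a ^ 2 ≠ b ^ 2) (hcd : c ^ 2 ≠ d ^ 2) (i : Fin 4) :
    qc i ⨯₃ auxVec a b c d i ≠ 0 := by
  rw [cross_qc_auxVec]
  refine Function.ne_iff.mpr ⟨0, ?_⟩
  have h1 := sub_ne_zero_of_sq_ne_sq hab.symm
  have h2 := neg_ne_zero.mpr (add_ne_zero_of_sq_ne_sq hab)
  have h3 := sub_ne_zero_of_sq_ne_sq hcd.symm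
  have h4 := neg_ne_zero.mpr (add_ne_zero_of_sq_ne_sq hcd)
  fin_cases i
  exacts [h3, h1, h4, h2]

theorem lineOf_qc_inter_auxLine (hab : a ^ 2 ≠ b ^ 2) (hcd : c ^ 2 ≠ d ^ 2) (i : Fin 4) :
    lineOf (qc i) ∩ auxLine (ptFive a b hab) (ptSix c d hcd) i =
      {Projectivization.mk ℂ _ (cross_qc_auxVec_ne_zero hab hcd i)} := by
  rw [auxLine_ptFive_ptSix, lineOf_inter_lineOf]

theorem mk_cross_qc_auxVec_injective (hab : a ^ 2 ≠ b ^ 2) (hcd : c ^ 2 ≠ d ^ 2)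
    (hb : b ≠ 0) (hd : d ≠ 0) : Function.Injective fun i : Fin 4 =>
      Projectivization.mk ℂ _ (cross_qc_auxVec_ne_zero hab hcd i) := by
  have h1 := sub_ne_zero_of_sq_ne_sq hab
  have h2 := add_ne_zero_of_sq_ne_sq hab
  have h3 := sub_ne_zero_of_sq_ne_sq hcd
  have h4 := add_ne_zero_of_sq_ne_sq hcd
  intro i j hij
  simp only at hij
  rw [Projectivization.mk_eq_mk_iff_crossProduct_eq_zero, cross_qc_auxVec, cross_qc_auxVec,
    cross_apply] at hij
  have e0 := congrFun hij 0
  have e1 := congrFun hij 1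
  have e2 := congrFun hij 2
  clear hij
  fin_cases i <;> fin_cases j <;> first | rfl | (exfalso; simp at e0 e1 e2; grind)

theorem eq_zero_of_collinear {v : Fin 3 → ℂ} (hv : v ≠ 0)
    (h : ∀ i, v ⬝ᵥ (qc i ⨯₃ auxVec a b c d i) = 0) :
    a * (c + d) ^ 2 + b * (c ^ 2 - 2 * c * d + 5 * d ^ 2) = 0 ∧
      a * (c - d) ^ 2 - b * (c ^ 2 + 2 * c * d + 5 * d ^ 2) = 0 := by
  have det_eq_zero (i j k : Fin 4) : Matrix.det (Matrix.of
      ![qc i ⨯₃ auxVec a b c d i, qc j ⨯₃ auxVec a b c d j, qc k ⨯₃ auxVec a b c d k]) = 0 := by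
    refine Matrix.exists_mulVec_eq_zero_iff.mp ⟨v, hv, ?_⟩
    ext l
    rw [Matrix.mulVec, dotProduct_comm]
    fin_cases l
    exacts [h i, h j, h k]
  have h1 := det_eq_zero 0 2 1
  have h2 := det_eq_zero 0 2 3
  simp only [cross_qc_auxVec, Matrix.det_fin_three, Matrix.of_apply, Matrix.cons_val] at h1 h2
  constructor
  · linear_combination h1 / 4
  · linear_combination -h2 / 4

theorem collinear_of_eq_zero
    (h1 : a * (c + d) ^ 2 + b * (c ^ 2 - 2 * c * d + 5 * d ^ 2) = 0)
    (h2 : a * (c - d) ^ 2 - b * (c ^ 2 + 2 * c * d + 5 * d ^ 2) = 0) (i : Fin 4) :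
    ![-4 * c * d, c ^ 2 - d ^ 2, -c ^ 2 - 3 * d ^ 2] ⬝ᵥ (qc i ⨯₃ auxVec a b c d i) = 0 := by
  rw [cross_qc_auxVec]
  fin_cases i <;> simp [dotProduct, Fin.sum_univ_three]
  · ring
  · linear_combination 2 * h1
  · ring
  · linear_combination -2 * h2

end Configuration

/-- The ratio `a / b` for the point `P₅ = [a : b : b]` attached to `ζ`. -/
noncomputable def ratioFive (ζ : ℂ) : ℂ := -1 - 2 * (ζ⁻¹ + ζ ^ 2)

/-- The ratio `c / d` for the point `P₆ = [c : d : -d]` attached to `ζ`. -/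
noncomputable def ratioSix (ζ : ℂ) : ℂ := 1 + 2 * (ζ⁻¹ ^ 2 + ζ⁻¹)

namespace IsPrimitiveRoot

variable {ζ : ℂ}

theorem inv_eq_pow_four (hζ : IsPrimitiveRoot ζ 5) : ζ⁻¹ = ζ ^ 4 :=
  inv_eq_of_mul_eq_one_right (by rw [← hζ.pow_eq_one]; ring)

theorem sum_pow_five_eq_zero (hζ : IsPrimitiveRoot ζ 5) : ζ ^ 4 + ζ ^ 3 + ζ ^ 2 + ζ + 1 = 0 := by
  have h := hζ.geom_sum_eq_zero (by norm_num)
  simp only [Finset.sum_range_succ, Finset.sum_range_zero] at h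
  linear_combination h

theorem ratioFive_mul (hζ : IsPrimitiveRoot ζ 5) : ratioFive ζ * (ζ + 1) = ζ - 1 := by
  have h := hζ.sum_pow_five_eq_zero
  rw [ratioFive, hζ.inv_eq_pow_four]
  grind

theorem ratioSix_mul (hζ : IsPrimitiveRoot ζ 5) : ratioSix ζ * (ζ ^ 3 + 1) = ζ ^ 3 - 1 := by
  have h := hζ.sum_pow_five_eq_zero
  rw [ratioSix, hζ.inv_eq_pow_four]
  grind

theorem ratioFive_ratioSix (hζ : IsPrimitiveRoot ζ 5) :
    (ratioFive ζ + 1) * (ratioSix ζ - 1) = 4 * ζ⁻¹ := by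
  have h := hζ.sum_pow_five_eq_zero
  rw [ratioFive, ratioSix, hζ.inv_eq_pow_four]
  grind

theorem ratioFive_sq_ne (hζ : IsPrimitiveRoot ζ 5) : ratioFive ζ ^ 2 ≠ 1 ^ 2 := by
  have h := hζ.ratioFive_mul
  have h0 := hζ.ne_zero (by norm_num)
  grind

theorem ratioSix_sq_ne (hζ : IsPrimitiveRoot ζ 5) : ratioSix ζ ^ 2 ≠ 1 ^ 2 := by
  have h := hζ.ratioSix_mul
  have h0 := pow_ne_zero 3 (hζ.ne_zero (by norm_num))
  grind

theorem ratio_collinear_left (hζ : IsPrimitiveRoot ζ 5) : ratioFive ζ * (ratioSix ζ + 1) ^ 2 +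
    1 * (ratioSix ζ ^ 2 - 2 * ratioSix ζ * 1 + 5 * 1 ^ 2) = 0 := by
  have h := hζ.sum_pow_five_eq_zero
  rw [ratioFive, ratioSix, hζ.inv_eq_pow_four]
  grind

theorem ratio_collinear_right (hζ : IsPrimitiveRoot ζ 5) : ratioFive ζ * (ratioSix ζ - 1) ^ 2 -
    1 * (ratioSix ζ ^ 2 + 2 * ratioSix ζ * 1 + 5 * 1 ^ 2) = 0 := by
  have h := hζ.sum_pow_five_eq_zero
  rw [ratioFive, ratioSix, hζ.inv_eq_pow_four]
  grind

end IsPrimitiveRoot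

theorem exists_isPrimitiveRoot_of_eq_zero {a b c d : ℂ} (hab : a ^ 2 ≠ b ^ 2)
    (hcd : c ^ 2 ≠ d ^ 2) (h1 : a * (c + d) ^ 2 + b * (c ^ 2 - 2 * c * d + 5 * d ^ 2) = 0)
    (h2 : a * (c - d) ^ 2 - b * (c ^ 2 + 2 * c * d + 5 * d ^ 2) = 0) :
    ∃ ζ : ℂ, IsPrimitiveRoot ζ 5 ∧ a = ratioFive ζ * b ∧ c = ratioSix ζ * d := by
  have h3 := sub_ne_zero_of_sq_ne_sq hcd.symm
  have h4 := add_ne_zero_of_sq_ne_sq hcd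
  have hb : b ≠ 0 := by
    rintro rfl
    have : a ≠ 0 := by rintro rfl; exact hab rfl
    exact mul_ne_zero this (pow_ne_zero 2 h4) (by linear_combination h1)
  have hd : d ≠ 0 := by
    rintro rfl
    have : c ≠ 0 := by rintro rfl; exact hcd rfl
    exact mul_ne_zero (add_ne_zero_of_sq_ne_sq hab) (pow_ne_zero 2 this)
      (by linear_combination h1)
  have hac : a * (c ^ 2 + d ^ 2) = 2 * b * c * d := by linear_combination (h1 + h2) / 2
  have hquart : c ^ 4 + 10 * c ^ 2 * d ^ 2 + 5 * d ^ 4 = 0 :=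
    (mul_eq_zero.mp (show b * (c ^ 4 + 10 * c ^ 2 * d ^ 2 + 5 * d ^ 4) = 0 by
      linear_combination (c ^ 2 + d ^ 2) * (h1 - h2) / 2 - 2 * c * d * hac)).resolve_left hb
  have hc : c ≠ 0 := by
    rintro rfl
    exact pow_ne_zero 4 hd (by linear_combination hquart / 5)
  obtain ⟨ω, hω⟩ : ∃ ω : ℂ, ω * (d - c) = d + c := ⟨(d + c) / (d - c), div_mul_cancel₀ _ h3⟩
  have hω5 : ω ^ 5 = 1 := by
    refine mul_right_cancel₀ (pow_ne_zero 5 h3) ?_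
    rw [← mul_pow, hω]
    linear_combination 2 * c * hquart
  have hω2 : ω ^ 2 * (d - c) ^ 2 = (d + c) ^ 2 := by rw [← mul_pow, hω]
  have hζ : IsPrimitiveRoot (ω ^ 2) 5 := by
    have : Fact (Nat.Prime 5) := ⟨by norm_num⟩
    refine IsPrimitiveRoot.iff_orderOf.mpr (orderOf_eq_prime ?_ fun h => ?_)
    · rw [← pow_mul, mul_comm, pow_mul, hω5, one_pow]
    · rw [h] at hω2
      exact mul_ne_zero hc hd (by linear_combination -hω2 / 4)
  have hω3 : (ω ^ 2) ^ 3 = ω := by linear_combination ω * hω5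
  refine ⟨ω ^ 2, hζ, ?_, ?_⟩
  · have h := hζ.ratioFive_mul
    have h0 : ω ^ 2 + 1 ≠ 0 := fun h0 => by
      rw [h0] at h
      have : (2 : ℂ) = 0 := by linear_combination h0 + h
      norm_num at this
    refine mul_right_cancel₀ h0 (mul_right_cancel₀ (pow_ne_zero 2 h3) ?_)
    linear_combination -b * (d - c) ^ 2 * h + (a - b) * hω2 + 2 * hac
  · have h := hζ.ratioSix_mul
    rw [hω3] at h
    have h0 : ω + 1 ≠ 0 := fun h0 => by
      rw [h0] at h
      have : (2 : ℂ) = 0 := by linear_combination h0 + h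
      norm_num at this
    refine mul_right_cancel₀ h0 ?_
    linear_combination -d * h - hω

/-- The pair `(P₅, P₆)` attached to a primitive fifth root of unity. -/
noncomputable def rootPair (ζ : ℂ) (hζ : IsPrimitiveRoot ζ 5) : P2 × P2 :=
  (ptFive (ratioFive ζ) 1 hζ.ratioFive_sq_ne, ptSix (ratioSix ζ) 1 hζ.ratioSix_sq_ne)

theorem exists_eq_rootPair {p5 p6 : P2} {q : Fin 4 → P2} (h5 : p5 ∈ lineOf ![0, 1, -1])
    (h6 : p6 ∈ lineOf ![0, 1, 1]) (h5' : ∀ i, p5 ∉ lineOf (qc i)) (h6' : ∀ i, p6 ∉ lineOf (qc i))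
    (hq : ∀ i, lineOf (qc i) ∩ auxLine p5 p6 i = {q i})
    (hv : ∃ v : Fin 3 → ℂ, v ≠ 0 ∧ ∀ i, q i ∈ lineOf v) :
    ∃ ζ, ∃ hζ : IsPrimitiveRoot ζ 5, (p5, p6) = rootPair ζ hζ := by
  obtain ⟨a, b, hab, rfl⟩ := exists_ptFive h5 h5'
  obtain ⟨c, d, hcd, rfl⟩ := exists_ptSix h6 h6'
  obtain ⟨v, hv0, hv⟩ := hv
  have hdot (i : Fin 4) : v ⬝ᵥ (qc i ⨯₃ auxVec a b c d i) = 0 := by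
    rw [← mk_mem_lineOf_iff (cross_qc_auxVec_ne_zero hab hcd i),
      Set.singleton_injective ((lineOf_qc_inter_auxLine hab hcd i).symm.trans (hq i))]
    exact hv i
  obtain ⟨h1, h2⟩ := eq_zero_of_collinear hv0 hdot
  obtain ⟨ζ, hζ, ha, hc⟩ := exists_isPrimitiveRoot_of_eq_zero hab hcd h1 h2
  refine ⟨ζ, hζ, Prod.ext ((ptFive_congr hab hζ.ratioFive_sq_ne).mpr ?_)
    ((ptSix_congr hcd hζ.ratioSix_sq_ne).mpr ?_)⟩
  · rw [mul_one, ha]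
  · rw [mul_one, hc]

theorem auxLine_rootPair {ζ : ℂ} (hζ : IsPrimitiveRoot ζ 5) (i : Fin 4) :
    auxLine (rootPair ζ hζ).1 (rootPair ζ hζ).2 i = lineOf (newCoeffs ζ i) := by
  have h := hζ.sum_pow_five_eq_zero
  have hk : (![1 / 2, 1 / 2, -1 / 2, -1 / 2] : Fin 4 → ℂ) i ≠ 0 := by
    fin_cases i <;> simp
  rw [rootPair, auxLine_ptFive_ptSix, ← lineOf_smul hk]
  congr 1
  ext k
  fin_cases i <;> fin_cases k <;>
    simp [auxVec, newCoeffs, ratioFive, ratioSix, - inv_pow] <;>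
    (try rw [hζ.inv_eq_pow_four]) <;> grind

theorem eq_rootPair_of_auxLine {p5 p6 : P2} {ζ : ℂ} (hζ : IsPrimitiveRoot ζ 5)
    (h5 : p5 ∈ lineOf ![0, 1, -1]) (h6 : p6 ∈ lineOf ![0, 1, 1])
    (h5' : ∀ i, p5 ∉ lineOf (qc i)) (h6' : ∀ i, p6 ∉ lineOf (qc i))
    (h : ∀ i, auxLine p5 p6 i = lineOf (newCoeffs ζ i)) : (p5, p6) = rootPair ζ hζ := by
  obtain ⟨a, b, hab, rfl⟩ := exists_ptFive h5 h5'
  obtain ⟨c, d, hcd, rfl⟩ := exists_ptSix h6 h6'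
  have hΦ := hζ.sum_pow_five_eq_zero
  have e5 : ptFive a b hab ∈ lineOf (newCoeffs ζ 1) := by
    rw [← h, auxLine_ptFive_ptSix, ptFive, mk_mem_lineOf_iff]
    simp [auxVec, dotProduct, Fin.sum_univ_three]
    ring
  have e6 : ptSix c d hcd ∈ lineOf (newCoeffs ζ 0) := by
    rw [← h, auxLine_ptFive_ptSix, ptSix, mk_mem_lineOf_iff]
    simp [auxVec, dotProduct, Fin.sum_univ_three]
    ring
  rw [ptFive, mk_mem_lineOf_iff] at e5
  rw [ptSix, mk_mem_lineOf_iff] at e6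
  simp only [newCoeffs, dotProduct, Fin.sum_univ_three, Matrix.cons_val,
    hζ.inv_eq_pow_four] at e5 e6
  refine Prod.ext ((ptFive_congr hab hζ.ratioFive_sq_ne).mpr ?_)
    ((ptSix_congr hcd hζ.ratioSix_sq_ne).mpr ?_)
  · rw [ratioFive, hζ.inv_eq_pow_four]
    grind
  · rw [ratioSix, hζ.inv_eq_pow_four]
    grind

theorem ptFive_notMem_lineOf_qc {a b : ℂ} (hab : a ^ 2 ≠ b ^ 2) (i : Fin 4) :
    ptFive a b hab ∉ lineOf (qc i) := by
  have h1 := sub_ne_zero_of_sq_ne_sq hab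
  have h2 := add_ne_zero_of_sq_ne_sq hab
  rw [ptFive, mk_mem_lineOf_iff]
  fin_cases i <;> simpa [qc, dotProduct, Fin.sum_univ_three, ← sub_eq_add_neg]

theorem ptSix_notMem_lineOf_qc {c d : ℂ} (hcd : c ^ 2 ≠ d ^ 2) (i : Fin 4) :
    ptSix c d hcd ∉ lineOf (qc i) := by
  have h1 := sub_ne_zero_of_sq_ne_sq hcd
  have h2 := add_ne_zero_of_sq_ne_sq hcd
  rw [ptSix, mk_mem_lineOf_iff]
  fin_cases i <;> simpa [qc, dotProduct, Fin.sum_univ_three, ← sub_eq_add_neg]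

theorem goodPair_rootPair {ζ : ℂ} (hζ : IsPrimitiveRoot ζ 5) :
    GoodPair (rootPair ζ hζ).1 (rootPair ζ hζ).2 := by
  refine ⟨?_, ?_, fun i => ⟨ptFive_notMem_lineOf_qc hζ.ratioFive_sq_ne i,
    ptSix_notMem_lineOf_qc hζ.ratioSix_sq_ne i⟩, _,
    mk_cross_qc_auxVec_injective hζ.ratioFive_sq_ne hζ.ratioSix_sq_ne one_ne_zero one_ne_zero,
    lineOf_qc_inter_auxLine hζ.ratioFive_sq_ne hζ.ratioSix_sq_ne,
    ![-4 * ratioSix ζ * 1, ratioSix ζ ^ 2 - 1 ^ 2, -ratioSix ζ ^ 2 - 3 * 1 ^ 2], ?_, fun i => ?_⟩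
  · rw [rootPair, ptFive, mk_mem_lineOf_iff]
    simp [dotProduct, Fin.sum_univ_three]
  · rw [rootPair, ptSix, mk_mem_lineOf_iff]
    simp [dotProduct, Fin.sum_univ_three]
  · exact Function.ne_iff.mpr ⟨1, sub_ne_zero.mpr hζ.ratioSix_sq_ne⟩
  · rw [mk_mem_lineOf_iff]
    exact collinear_of_eq_zero hζ.ratio_collinear_left hζ.ratio_collinear_right i

theorem rootPair_injective {ζ ξ : ℂ} (hζ : IsPrimitiveRoot ζ 5) (hξ : IsPrimitiveRoot ξ 5)
    (h : rootPair ζ hζ = rootPair ξ hξ) : ζ = ξ := by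
  have h5 := (ptFive_congr hζ.ratioFive_sq_ne hξ.ratioFive_sq_ne).mp (congrArg Prod.fst h)
  have h6 := (ptSix_congr hζ.ratioSix_sq_ne hξ.ratioSix_sq_ne).mp (congrArg Prod.snd h)
  rw [mul_one, mul_one] at h5 h6
  have h' := hζ.ratioFive_ratioSix
  rw [h5, h6, hξ.ratioFive_ratioSix] at h'
  exact inv_injective (mul_left_cancel₀ (by norm_num) h').symm

theorem ncard_goodPair : {pq : P2 × P2 | GoodPair pq.1 pq.2}.ncard = 4 := by
  have hrange : {pq : P2 × P2 | GoodPair pq.1 pq.2} =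
      Set.range fun ζ : primitiveRoots 5 ℂ =>
        rootPair ζ (isPrimitiveRoot_of_mem_primitiveRoots ζ.2) := by
    ext ⟨p5, p6⟩
    constructor
    · rintro ⟨h5, h6, h', q, -, hq, hv⟩
      obtain ⟨ζ, hζ, h⟩ := exists_eq_rootPair h5 h6 (fun i => (h' i).1) (fun i => (h' i).2) hq hv
      exact ⟨⟨ζ, (mem_primitiveRoots (by norm_num)).mpr hζ⟩, h.symm⟩
    · rintro ⟨ζ, h⟩
      have := goodPair_rootPair (isPrimitiveRoot_of_mem_primitiveRoots ζ.2)
      simp only at h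
      rwa [h] at this
  rw [hrange, ← Set.image_univ, Set.ncard_image_of_injective, Set.ncard_univ,
    Nat.card_eq_fintype_card, Fintype.card_coe, Complex.card_primitiveRoots]
  · decide
  · exact fun ζ ξ h => Subtype.ext (rootPair_injective _ _ h)

/-- The collinearity of `Q₁, Q₂, Q₃, Q₄` holds iff the lines `L₇,…,L₁₀` come from a
primitive fifth root of unity; in particular there are exactly four such pairs
`(P₅, P₆)`. -/
theorem statement8 (p5 p6 : P2) (q : Fin 4 → P2)
    (h5 : p5 ∈ lineOf ![0, 1, -1]) (h6 : p6 ∈ lineOf ![0, 1, 1])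
    (h5' : ∀ i : Fin 4, p5 ∉ lineOf (qc i)) (h6' : ∀ i : Fin 4, p6 ∉ lineOf (qc i))
    (hq : ∀ i : Fin 4, lineOf (qc i) ∩ auxLine p5 p6 i = {q i})
    (hdist : Function.Injective q) :
    ((∃ v : Fin 3 → ℂ, v ≠ 0 ∧ ∀ i : Fin 4, q i ∈ lineOf v) ↔
      ∃ ζ : ℂ, IsPrimitiveRoot ζ 5 ∧
        ∀ i : Fin 4, auxLine p5 p6 i = lineOf (newCoeffs ζ i)) ∧
    {pq : P2 × P2 | GoodPair pq.1 pq.2}.ncard = 4 := by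
  refine ⟨⟨fun hv => ?_, ?_⟩, ncard_goodPair⟩
  · obtain ⟨ζ, hζ, h⟩ := exists_eq_rootPair h5 h6 h5' h6' hq hv
    obtain ⟨rfl, rfl⟩ := Prod.mk.inj h
    exact ⟨ζ, hζ, auxLine_rootPair hζ⟩
  · rintro ⟨ζ, hζ, h⟩
    obtain ⟨rfl, rfl⟩ := Prod.mk.inj (eq_rootPair_of_auxLine hζ h5 h6 h5' h6' h)
    obtain ⟨-, -, -, q', -, hq', hv⟩ := goodPair_rootPair hζ
    obtain rfl : q = q' := funext fun i => Set.singleton_injective ((hq i).symm.trans (hq' i))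
    exact hv
end

section
/- For 𝒞 = 𝒜G, the quotient abelian group (H₁∧H₁)/H₂ is free abelian of rank 23. -/
/-- The wedge product `x ∧ y` as an element of the second exterior power `⋀²H₁` over `ℤ`. -/
noncomputable def wedge2 (x y : H1) : ⋀[ℤ]^2 H1 :=
  ⟨ExteriorAlgebra.ιMulti ℤ 2 ![x, y], ExteriorAlgebra.ιMulti_range ℤ 2 (Set.mem_range_self _)⟩

/-- `H₂ ⊆ H₁∧H₁`: the subgroup generated by the elements `x_L ∧ x_P`, `L ∈ P ∈ 𝒫`. -/
noncomputable def H2sub : Submodule ℤ (⋀[ℤ]^2 H1) :=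
  Submodule.span ℤ {w | ∃ P ∈ calP, ∃ L ∈ P, w = wedge2 (xL L) (xP P)}

namespace LineCombinatorics

/-- The triples `(p, i, j)` such that some `P ∈ 𝒫` has least element `p` and `p < i < j` in `P`. -/
def localTriple : Fin 23 → Fin 12 × Fin 12 × Fin 12 :=
  ![(0, 3, 4), (0, 3, 8), (0, 3, 11), (0, 4, 8), (0, 4, 11), (0, 8, 11),
    (0, 1, 5), (0, 1, 9), (0, 5, 9), (1, 2, 4), (1, 2, 6), (1, 4, 6),
    (2, 3, 5), (2, 3, 7), (2, 5, 7), (1, 7, 10), (1, 7, 11), (1, 10, 11),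
    (0, 6, 10), (2, 8, 10), (3, 9, 10), (4, 7, 9), (5, 6, 8)]

/-- The functional `v ↦ v i - v p` on `H₁`. -/
def coordDiff (p i : Fin 12) : H1 →ₗ[ℤ] ℤ :=
  Submodule.liftQ _
    { toFun := fun v => v i - v p
      map_add' := fun v w => by simp only [Pi.add_apply]; ring
      map_smul' := fun c v => by simp [mul_sub] } (by simp [Submodule.span_le])

/-- The value of `coordDiff p i` on `x_L`. -/
def coordDiffVal (p i L : Fin 12) : ℤ := (if i = L then 1 else 0) - (if p = L then 1 else 0)

lemma coordDiff_xL (p i L : Fin 12) : coordDiff p i (xL L) = coordDiffVal p i L := by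
  simp [coordDiff, xL, coordDiffVal, Pi.single_apply]

/-- The linear form on `⋀²H₁` sending `v ∧ w` to the minor attached to the triple `t`. -/
noncomputable def minor (t : Fin 12 × Fin 12 × Fin 12) : ⋀[ℤ]^2 H1 →ₗ[ℤ] ℤ :=
  exteriorPower.alternatingMapLinearEquiv
    (Matrix.detRowAlternating.compLinearMap
      (LinearMap.pi ![coordDiff t.1 t.2.1, coordDiff t.1 t.2.2]))

lemma wedge2_eq_ιMulti (x y : H1) : wedge2 x y = exteriorPower.ιMulti ℤ 2 ![x, y] := rfl

lemma minor_wedge2 (t : Fin 12 × Fin 12 × Fin 12) (x y : H1) :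
    minor t (wedge2 x y) = coordDiff t.1 t.2.1 x * coordDiff t.1 t.2.2 y -
      coordDiff t.1 t.2.2 x * coordDiff t.1 t.2.1 y := by
  rw [wedge2_eq_ιMulti, minor, exteriorPower.alternatingMapLinearEquiv_apply_ιMulti]
  exact Matrix.det_fin_two _

lemma coordDiff_xP (p i : Fin 12) (P : Finset (Fin 12)) :
    coordDiff p i (xP P) = (if i ∈ P then 1 else 0) - (if p ∈ P then 1 else 0) := by
  simp [xP, coordDiff_xL, coordDiffVal]

/-- The points of `𝒫` as lists, on which statements about `𝒫` are quick to decide. -/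
def pointList : List (List (Fin 12)) :=
  [[0, 3, 4, 8, 11], [0, 1, 5, 9], [1, 2, 4, 6], [2, 3, 5, 7], [1, 7, 10, 11],
    [0, 6, 10], [2, 8, 10], [3, 9, 10], [4, 7, 9], [5, 6, 8],
    [4, 5], [4, 10], [5, 10], [0, 2], [1, 3], [0, 7], [1, 8], [2, 9], [3, 6],
    [6, 7], [6, 9], [7, 8], [8, 9], [2, 11], [5, 11], [6, 11], [9, 11]]

lemma mem_calP (P : Finset (Fin 12)) : P ∈ calP ↔ ∃ l ∈ pointList, l.toFinset = P := by
  simp only [calP, pointList, Finset.mem_insert, Finset.mem_singleton, List.exists_mem_cons_iff,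
    List.not_mem_nil, false_and, exists_false, or_false, List.toFinset_cons, List.toFinset_nil,
    insert_empty_eq, eq_comm (a := P)]

/-- A point of `𝒫` contains either all of a local triple or at most one of its entries. -/
lemma localTriple_mem : ∀ l ∈ pointList, ∀ k,
    ((localTriple k).1 ∈ l ∧ (localTriple k).2.1 ∈ l ∧ (localTriple k).2.2 ∈ l) ∨
    ((localTriple k).1 ∉ l ∧ (localTriple k).2.1 ∉ l) ∨
    ((localTriple k).1 ∉ l ∧ (localTriple k).2.2 ∉ l) ∨
    ((localTriple k).2.1 ∉ l ∧ (localTriple k).2.2 ∉ l) := by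
  decide +kernel

lemma minor_wedge2_xP {P : Finset (Fin 12)} (hP : P ∈ calP) {L : Fin 12} (hL : L ∈ P)
    (k : Fin 23) : minor (localTriple k) (wedge2 (xL L) (xP P)) = 0 := by
  have ne {i} (hi : i ∉ P) : i ≠ L := fun h => hi (h ▸ hL)
  obtain ⟨l, hl, rfl⟩ := (mem_calP P).1 hP
  simp only [List.mem_toFinset] at ne
  rw [minor_wedge2]
  rcases localTriple_mem l hl k with ⟨hp, hi, hj⟩ | ⟨hp, hi⟩ | ⟨hp, hj⟩ | ⟨hi, hj⟩
  · simp [coordDiff_xP, hp, hi, hj]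
  · simp [coordDiff_xP, coordDiff_xL, coordDiffVal, hp, hi, ne]
  · simp [coordDiff_xP, coordDiff_xL, coordDiffVal, hp, hj, ne]
  · simp [coordDiff_xP, coordDiff_xL, coordDiffVal, hi, hj, ne]

lemma minor_wedge2_localTriple (k l : Fin 23) :
    minor (localTriple l) (wedge2 (xL (localTriple k).2.1) (xL (localTriple k).2.2)) =
      if l = k then 1 else 0 := by
  simp only [minor_wedge2, coordDiff_xL]
  revert k l
  decide +kernel

lemma exists_mem_pointList : ∀ i j : Fin 12, ∃ l ∈ pointList, i ∈ l ∧ j ∈ l := by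
  decide +kernel

lemma exists_localTriple : ∀ l ∈ pointList, ∃ p ∈ l, ∀ i ∈ l, ∀ j ∈ l, i ≠ p → j ≠ p → i < j →
    ∃ k, localTriple k = (p, i, j) := by
  decide +kernel

/-- The minors of the local triples, as a map on `(H₁ ∧ H₁) / H₂`. -/
noncomputable def minors : (⋀[ℤ]^2 H1) ⧸ H2sub →ₗ[ℤ] (Fin 23 → ℤ) :=
  H2sub.liftQ (LinearMap.pi fun k => minor (localTriple k)) (by
    rw [H2sub, Submodule.span_le]
    rintro _ ⟨P, hP, L, hL, rfl⟩
    ext k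
    exact minor_wedge2_xP hP hL k)

/-- The class of `x_i ∧ x_j` in `(H₁ ∧ H₁) / H₂`. -/
noncomputable def wedgeClass (i j : Fin 12) : (⋀[ℤ]^2 H1) ⧸ H2sub :=
  H2sub.mkQ (wedge2 (xL i) (xL j))

lemma wedge2_self (x : H1) : wedge2 x x = 0 :=
  (exteriorPower.ιMulti ℤ 2).map_eq_zero_of_eq ![x, x] (i := 0) (j := 1) rfl (by decide)

lemma wedge2_swap (x y : H1) : wedge2 y x = -wedge2 x y := by
  have h := (exteriorPower.ιMulti ℤ 2).map_swap ![x, y] (i := 0) (j := 1) (by decide)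
  rw [wedge2_eq_ιMulti, wedge2_eq_ιMulti, ← h]
  congr 1
  ext i
  fin_cases i <;> rfl

lemma wedge2_sum (x : H1) (s : Finset (Fin 12)) (f : Fin 12 → H1) :
    wedge2 x (∑ i ∈ s, f i) = ∑ i ∈ s, wedge2 x (f i) := by
  have update (z : H1) : Function.update ![x, 0] 1 z = ![x, z] := by
    ext i
    fin_cases i <;> rfl
  simpa only [wedge2_eq_ιMulti, update] using
    (exteriorPower.ιMulti ℤ 2 (M := H1)).map_update_sum s 1 f ![x, 0]

lemma sum_wedgeClass {P : Finset (Fin 12)} (hP : P ∈ calP) {L : Fin 12} (hL : L ∈ P) :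
    ∑ j ∈ P, wedgeClass L j = 0 := by
  simp only [wedgeClass, ← map_sum, ← wedge2_sum]
  exact (Submodule.Quotient.mk_eq_zero _).2 (Submodule.subset_span ⟨P, hP, L, hL, rfl⟩)

lemma wedgeClass_mem (R : Submodule ℤ ((⋀[ℤ]^2 H1) ⧸ H2sub))
    (hR : ∀ k, wedgeClass (localTriple k).2.1 (localTriple k).2.2 ∈ R) (i j : Fin 12) :
    wedgeClass i j ∈ R := by
  have self (i) : wedgeClass i i ∈ R := by simp [wedgeClass, wedge2_self]
  have swap {i j} (h : wedgeClass i j ∈ R) : wedgeClass j i ∈ R := by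
    rw [wedgeClass, wedge2_swap, map_neg]
    exact R.neg_mem h
  obtain ⟨l, hl, hi, hj⟩ := exists_mem_pointList i j
  obtain ⟨p, hp, htriple⟩ := exists_localTriple l hl
  have lt {i j} (hi : i ∈ l) (hj : j ∈ l) (hip : i ≠ p) (hjp : j ≠ p) (hij : i < j) :
      wedgeClass i j ∈ R := by
    obtain ⟨k, hk⟩ := htriple i hi j hj hip hjp hij
    simpa [hk] using hR k
  have ne {i j} (hi : i ∈ l) (hj : j ∈ l) (hip : i ≠ p) (hjp : j ≠ p) : wedgeClass i j ∈ R := by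
    rcases lt_trichotomy i j with h | rfl | h
    · exact lt hi hj hip hjp h
    · exact self i
    · exact swap (lt hj hi hjp hip h)
  have base {i} (hi : i ∈ l) : wedgeClass i p ∈ R := by
    by_cases hip : i = p
    · exact hip ▸ self i
    have hsum := sum_wedgeClass ((mem_calP _).2 ⟨l, hl, rfl⟩) (List.mem_toFinset.2 hi)
    rw [← Finset.add_sum_erase _ _ (List.mem_toFinset.2 hp)] at hsum
    rw [eq_neg_of_add_eq_zero_left hsum]
    refine R.neg_mem (R.sum_mem fun j hj => ?_)
    exact ne hi (List.mem_toFinset.1 (Finset.mem_of_mem_erase hj)) hip (Finset.ne_of_mem_erase hj)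
  by_cases hjp : j = p
  · rw [hjp]
    exact base hi
  by_cases hip : i = p
  · rw [hip]
    exact swap (base hj)
  exact ne hi hj hip hjp

lemma eq_zero_of_wedge2_xL {N : Type*} [AddCommGroup N] (f : ⋀[ℤ]^2 H1 →ₗ[ℤ] N)
    (hf : ∀ i j, f (wedge2 (xL i) (xL j)) = 0) : f = 0 := by
  apply exteriorPower.linearMap_ext
  have h : (f.compAlternatingMap (exteriorPower.ιMulti ℤ 2)).compLinearMap
      (Submodule.mkQ (Submodule.span ℤ {(fun _ => (1 : ℤ) : Fin 12 → ℤ)})) = 0 := by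
    refine Module.Basis.ext_alternating (Pi.basisFun ℤ (Fin 12)) fun v _ => ?_
    have hv : (fun i => (Submodule.mkQ (Submodule.span ℤ {(fun _ => (1 : ℤ) : Fin 12 → ℤ)}))
        (Pi.basisFun ℤ (Fin 12) (v i))) = ![xL (v 0), xL (v 1)] := by
      ext i
      fin_cases i <;> simp [xL]
    exact (congrArg (f ∘ exteriorPower.ιMulti ℤ 2) hv).trans (hf (v 0) (v 1))
  exact AlternatingMap.compLinearMap_injective _ (Submodule.mkQ_surjective _) (by simpa using h)

lemma eq_top_of_wedgeClass_mem (R : Submodule ℤ ((⋀[ℤ]^2 H1) ⧸ H2sub))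
    (hR : ∀ i j, wedgeClass i j ∈ R) : R = ⊤ := by
  have h : R.mkQ ∘ₗ H2sub.mkQ = 0 := eq_zero_of_wedge2_xL _ fun i j =>
    (Submodule.Quotient.mk_eq_zero _).2 (hR i j)
  refine eq_top_iff.2 fun x _ => ?_
  obtain ⟨y, rfl⟩ := H2sub.mkQ_surjective x
  exact (Submodule.Quotient.mk_eq_zero _).1 (LinearMap.congr_fun h y)

/-- The map sending the `k`-th basis vector to the class of `x_i ∧ x_j`, where `(p, i, j)` is the
`k`-th local triple. -/
noncomputable def ofLocalTriples : (Fin 23 → ℤ) →ₗ[ℤ] (⋀[ℤ]^2 H1) ⧸ H2sub :=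
  Fintype.linearCombination ℤ fun k => wedgeClass (localTriple k).2.1 (localTriple k).2.2

lemma ofLocalTriples_single (k : Fin 23) : ofLocalTriples (Pi.single k 1) =
    wedgeClass (localTriple k).2.1 (localTriple k).2.2 := by
  simp [ofLocalTriples]

lemma minors_comp_ofLocalTriples : minors ∘ₗ ofLocalTriples = LinearMap.id := by
  refine (Pi.basisFun ℤ (Fin 23)).ext fun k => ?_
  ext l
  simp [ofLocalTriples_single, minors, wedgeClass, minor_wedge2_localTriple,
    Pi.single_apply]

lemma ofLocalTriples_surjective : Function.Surjective ofLocalTriples :=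
  LinearMap.range_eq_top.1 <| eq_top_of_wedgeClass_mem _ <| wedgeClass_mem _ fun k =>
    ⟨Pi.single k 1, ofLocalTriples_single k⟩

end LineCombinatorics

/-- For `𝒞 = 𝒜G`, the quotient `(H₁∧H₁)/H₂` is free abelian of rank `23`. -/
theorem statement12 : Nonempty (((⋀[ℤ]^2 H1) ⧸ H2sub) ≃+ (Fin 23 → ℤ)) := by
  have hinj : Function.Injective LineCombinatorics.ofLocalTriples :=
    Function.LeftInverse.injective (g := LineCombinatorics.minors)
      (LinearMap.congr_fun LineCombinatorics.minors_comp_ofLocalTriples)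
  exact ⟨(LinearEquiv.ofBijective _
    ⟨hinj, LineCombinatorics.ofLocalTriples_surjective⟩).symm.toAddEquiv⟩
end

section
/- Let A be a 12×12 matrix with integer entries such that for every P ∈ 𝒫 of the combinatorics 𝒜G with |P| ≥ 3 and for all i, i′ ∈ P and every column index j ∉ P, one has A[i,j] = A[i′,j]. Then every column of A is constant off the diagonal: for every j and all i, i′ with i ≠ j and i′ ≠ j, A[i,j] = A[i′,j]. Equivalently, A = D + 𝟙·cᵀ for some diagonal integer matrix D, where 𝟙 is the all-ones column vector and c ∈ ℤ¹². -/
/-- The points of `𝒜G` lying on at least three lines. -/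
def multiplePoints : List (Finset (Fin 12)) :=
  [{0, 3, 4, 8, 11}, {0, 1, 5, 9}, {1, 2, 4, 6}, {2, 3, 5, 7}, {1, 7, 10, 11},
    {0, 6, 10}, {2, 8, 10}, {3, 9, 10}, {4, 7, 9}, {5, 6, 8}]

theorem mem_calP_of_mem_multiplePoints :
    ∀ P ∈ multiplePoints, P ∈ calP ∧ 3 ≤ P.card := by
  intro P hP
  simp only [multiplePoints, List.mem_cons, List.not_mem_nil, or_false] at hP
  constructor
  · simp only [calP, Finset.mem_insert, Finset.mem_singleton]
    tauto
  · rcases hP with rfl | rfl | rfl | rfl | rfl | rfl | rfl | rfl | rfl | rfl <;> decide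

/-- `i` and `i'` both lie on a multiple point that avoids `j`. -/
def JoinedAvoiding (j i i' : Fin 12) : Prop :=
  ∃ P ∈ multiplePoints, i ∈ P ∧ i' ∈ P ∧ j ∉ P

instance (j i i' : Fin 12) : Decidable (JoinedAvoiding j i i') :=
  inferInstanceAs (Decidable (∃ P ∈ multiplePoints, i ∈ P ∧ i' ∈ P ∧ j ∉ P))

theorem exists_joinedAvoiding :
    ∀ j i i' : Fin 12, i ≠ j → i' ≠ j →
      ∃ k, JoinedAvoiding j i k ∧ JoinedAvoiding j k i' := by
  decide +kernel

/-- If a `12×12` integer matrix `A` satisfies: for every point `P ∈ 𝒫` of `𝒜G` with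
`|P| ≥ 3`, all rows indexed by `P` agree on every column outside `P`, then every column of
`A` is constant off the diagonal; equivalently `A = D + 𝟙·cᵀ` with `D` diagonal. -/
theorem statement17 (A : Matrix (Fin 12) (Fin 12) ℤ)
    (h : ∀ P ∈ calP, 3 ≤ P.card →
      ∀ i ∈ P, ∀ i' ∈ P, ∀ j, j ∉ P → A i j = A i' j) :
    (∀ (j i i' : Fin 12), i ≠ j → i' ≠ j → A i j = A i' j) ∧
    ∃ (d c : Fin 12 → ℤ), A = Matrix.diagonal d + Matrix.of (fun _ j => c j) := by
  have joined : ∀ {j i i' : Fin 12}, JoinedAvoiding j i i' → A i j = A i' j := by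
    rintro j i i' ⟨P, hP, hi, hi', hj⟩
    obtain ⟨hmem, hcard⟩ := mem_calP_of_mem_multiplePoints P hP
    exact h P hmem hcard i hi i' hi' j hj
  have const : ∀ j i i' : Fin 12, i ≠ j → i' ≠ j → A i j = A i' j := by
    intro j i i' hi hi'
    obtain ⟨k, hik, hki'⟩ := exists_joinedAvoiding j i i' hi hi'
    exact (joined hik).trans (joined hki')
  refine ⟨const, fun j => A j j - A (j + 1) j, fun j => A (j + 1) j, ?_⟩
  ext i j
  obtain rfl | hij := eq_or_ne i j
  · simp
  · have hj : j + 1 ≠ j := by simp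
    simpa [Matrix.diagonal_apply_ne _ hij] using const j i (j + 1) hij hj
end
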